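/- arXiv:0805.1673 — 3 statements merged into one kernel-verified Lean document; each statement's English description precedes it below -/
import Mathlib

section
/- (Trace lemma) For $n \ge 2$ and $1/2 < s < n/2$, there is a constant $C$ such that for all Schwartz functions $v$ on $\mathbb{R}^n$ and all $r > 0$, $r^{n/2 - s}\left(\int_{S^{n-1}} |v(r\omega)|^2 \, d\sigma(\omega)\right)^{1/2} \le C \|v\|_{\dot H^s(\mathbb{R}^n)}$. -/
open MeasureTheory Real Set FourierTransform
open scoped RealInnerProductSpace

noncomputable section

abbrev Euc (n : ℕ) := EuclideanSpace ℝ (Fin n)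

/-- Fourier multiplier operator with symbol `m`. -/
def mulOp {n : ℕ} (m : Euc n → ℂ) (f : Euc n → ℂ) (x : Euc n) : ℂ :=
  ∫ ξ : Euc n, Complex.exp (2 * π * Complex.I * (⟪x, ξ⟫ : ℝ)) * m ξ * (𝓕 f ξ)

/-- Half-wave propagator `e^{it|D|}`. -/
def halfWave {n : ℕ} (t : ℝ) (f : Euc n → ℂ) : Euc n → ℂ :=
  mulOp (fun ξ => Complex.exp (Complex.I * t * ‖ξ‖)) f

/-- Homogeneous Sobolev norm `‖f‖_{Ḣˢ}`. -/
def hSob (n : ℕ) (s : ℝ) (f : Euc n → ℂ) : ℝ :=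
  (∫ ξ : Euc n, ‖ξ‖ ^ (2 * s) * ‖𝓕 f ξ‖ ^ 2) ^ (1/2 : ℝ)

/-- Inhomogeneous Sobolev norm `‖f‖_{Hˢ}`. -/
def iSob (n : ℕ) (s : ℝ) (f : Euc n → ℂ) : ℝ :=
  (∫ ξ : Euc n, (1 + ‖ξ‖ ^ 2) ^ s * ‖𝓕 f ξ‖ ^ 2) ^ (1/2 : ℝ)

/-- `L²` norm of `g` on the sphere of radius `r` (unit-sphere surface measure). -/
def sphL2 {n : ℕ} (g : Euc n → ℂ) (r : ℝ) : ℝ :=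
  (∫ ω : Metric.sphere (0 : Euc n) 1, ‖g (r • (ω : Euc n))‖ ^ 2
      ∂((volume : Measure (Euc n)).toSphere)) ^ (1/2 : ℝ)


abbrev Sph (n : ℕ) := Metric.sphere (0 : Euc n) 1

abbrev sigS (n : ℕ) : Measure (Sph n) := (volume : Measure (Euc n)).toSphere

lemma lintegral_polar {n : ℕ} (hn : 1 ≤ n) (f : Euc n → ENNReal) :
    ∫⁻ x, f x = ∫⁻ p, f (p.2.1 • (p.1 : Euc n))
      ∂((sigS n).prod (Measure.volumeIoiPow (n - 1))) := by
  have : Nonempty (Fin n) := ⟨⟨0, hn⟩⟩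
  have h := (volume : Measure (Euc n)).measurePreserving_homeomorphUnitSphereProd
  have hd : Module.finrank ℝ (Euc n) = n := by simp
  rw [hd] at h
  rw [← h.lintegral_comp_emb (Homeomorph.measurableEmbedding _)]
  have h0 : ∫⁻ x, f x = ∫⁻ x in ({0}ᶜ : Set (Euc n)), f x := by
    rw [restrict_compl_singleton]
  rw [h0, ← lintegral_subtype_comap (by measurability)]
  refine lintegral_congr fun x => ?_
  have hx : (x : Euc n) ≠ 0 := x.2
  congr 1
  simp [smul_smul, hx]

lemma volIoi_lower (k : ℕ) (δ : ℝ) :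
    ENNReal.ofReal δ ≤ Measure.volumeIoiPow k {ρ | ρ.1 ∈ Ioo (1 : ℝ) (1 + δ)} := by
  have hm : MeasurableSet {ρ : Ioi (0 : ℝ) | ρ.1 ∈ Ioo (1 : ℝ) (1 + δ)} :=
    measurable_subtype_coe measurableSet_Ioo
  rw [Measure.volumeIoiPow, withDensity_apply _ hm]
  have h1 : (Measure.comap Subtype.val volume : Measure (Ioi (0:ℝ)))
      {ρ : Ioi (0 : ℝ) | ρ.1 ∈ Ioo (1 : ℝ) (1 + δ)} = ENNReal.ofReal δ := by
    rw [(MeasurableEmbedding.subtype_coe measurableSet_Ioi).comap_apply]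
    have : (Subtype.val '' {ρ : Ioi (0 : ℝ) | ρ.1 ∈ Ioo (1 : ℝ) (1 + δ)}) = Ioo 1 (1 + δ) := by
      ext x
      simp only [mem_image, mem_ofPred_eq, Subtype.exists, mem_Ioi, mem_Ioo]
      constructor
      · rintro ⟨a, ha, h, rfl⟩; exact h
      · intro h; exact ⟨x, by linarith [h.1], h, rfl⟩
    rw [this]; simp
  rw [← h1, ← setLIntegral_one]
  refine setLIntegral_mono' hm fun ρ hρ => ?_
  rw [← ENNReal.ofReal_one]
  exact ENNReal.ofReal_le_ofReal (one_le_pow₀ hρ.1.le)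

lemma norm_sub_polar {n : ℕ} (ω ω' : Sph n) (ρ : ℝ) :
    ‖ρ • (ω' : Euc n) - ω‖ ^ 2 = (ρ - 1) ^ 2 + ρ * ‖(ω : Euc n) - ω'‖ ^ 2 := by
  have h1 : ‖(ω : Euc n)‖ = 1 := by simp
  have h2 : ‖(ω' : Euc n)‖ = 1 := by simp
  rw [norm_sub_sq_real, norm_sub_sq_real, norm_smul, inner_smul_left, mul_pow, h1, h2,
    real_inner_comm]
  simp
  ring

lemma gauss_sphere {n : ℕ} (hn : 1 ≤ n) (b : ℝ) (hb : 1 ≤ b) (ω : Sph n) :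
    ∫⁻ ω' : Sph n, ENNReal.ofReal (rexp (-b * ‖(ω : Euc n) - ω'‖ ^ 2)) ∂(sigS n)
      ≤ ENNReal.ofReal (rexp (1/2) * (2 * π) ^ ((n : ℝ) / 2) * b ^ (-((n : ℝ) - 1) / 2)) := by
  have hb0 : 0 < b := by linarith
  set δ : ℝ := b ^ (-(1/2) : ℝ) with hδ
  have hδ0 : 0 < δ := by positivity
  have hδ1 : δ ≤ 1 := Real.rpow_le_one_of_one_le_of_nonpos hb (by norm_num)
  have hδ2 : b * δ ^ 2 = 1 := by
    rw [hδ, ← Real.rpow_natCast, ← Real.rpow_mul hb0.le]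
    norm_num
    rw [Real.rpow_neg_one, mul_inv_cancel₀ hb0.ne']
  have htot : ∫⁻ x : Euc n, ENNReal.ofReal (rexp (-(b/2) * ‖x - ω‖ ^ 2))
      = ENNReal.ofReal ((2 * π / b) ^ ((n : ℝ) / 2)) := by
    rw [lintegral_sub_right_eq_self (fun x : Euc n => ENNReal.ofReal (rexp (-(b/2) * ‖x‖ ^ 2)))]
    have hi := GaussianFourier.integral_rexp_neg_mul_sq_norm (V := Euc n) (b := b/2) (by positivity)
    have hI : Integrable (fun x : Euc n => rexp (-(b/2) * ‖x‖ ^ 2)) := by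
      apply Integrable.of_integral_ne_zero
      rw [hi]; positivity
    rw [← ofReal_integral_eq_lintegral_ofReal hI (ae_of_all _ fun x => (Real.exp_pos _).le), hi]
    congr 2
    · field_simp
    · simp
  rw [lintegral_polar hn] at htot
  set A := {ρ : Ioi (0 : ℝ) | ρ.1 ∈ Ioo (1 : ℝ) (1 + δ)} with hA
  have hAm : MeasurableSet A := measurable_subtype_coe measurableSet_Ioo
  have hle : (∫⁻ ω' : Sph n, ENNReal.ofReal (rexp (-b * ‖(ω : Euc n) - ω'‖ ^ 2)) ∂(sigS n)) *
      (ENNReal.ofReal (rexp (-(1/2))) * ENNReal.ofReal δ) ≤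
      ENNReal.ofReal ((2 * π / b) ^ ((n : ℝ) / 2)) := by
    rw [← htot]
    calc _ ≤ (∫⁻ ω' : Sph n, ENNReal.ofReal (rexp (-b * ‖(ω : Euc n) - ω'‖ ^ 2)) ∂(sigS n)) *
          (ENNReal.ofReal (rexp (-(1/2))) * Measure.volumeIoiPow (n-1) A) := by
          gcongr; exact volIoi_lower _ _
      _ = (∫⁻ ω' : Sph n, ENNReal.ofReal (rexp (-b * ‖(ω : Euc n) - ω'‖ ^ 2)) ∂(sigS n)) *
          ∫⁻ ρ, A.indicator (fun _ => ENNReal.ofReal (rexp (-(1/2)))) ρ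
            ∂(Measure.volumeIoiPow (n-1)) := by
          rw [lintegral_indicator_const hAm]
      _ = ∫⁻ p, ENNReal.ofReal (rexp (-b * ‖(ω : Euc n) - p.1‖ ^ 2)) *
            A.indicator (fun _ => ENNReal.ofReal (rexp (-(1/2)))) p.2
            ∂((sigS n).prod (Measure.volumeIoiPow (n - 1))) := by
          symm
          apply lintegral_prod_mul (f := fun ω' : Sph n =>
            ENNReal.ofReal (rexp (-b * ‖(ω : Euc n) - ω'‖ ^ 2)))
          · fun_prop
          · exact (measurable_const.indicator hAm).aemeasurable
      _ ≤ _ := by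
          refine lintegral_mono fun p => ?_
          by_cases hp : p.2 ∈ A
          · rw [indicator_of_mem hp, ← ENNReal.ofReal_mul (Real.exp_pos _).le, ← Real.exp_add]
            apply ENNReal.ofReal_le_ofReal
            apply Real.exp_le_exp.2
            rw [norm_sub_polar]
            obtain ⟨h1, h2⟩ := hp
            have h3 : (p.2.1 - 1) ^ 2 ≤ δ ^ 2 := by
              apply pow_le_pow_left₀ <;> linarith
            have h4 : b * (p.2.1 - 1) ^ 2 ≤ 1 := by
              calc _ ≤ b * δ ^ 2 := by gcongr
                _ = 1 := hδ2
            have h5 : p.2.1 * (b * ‖(ω : Euc n) - p.1‖ ^ 2) ≤ 2 * (b * ‖(ω : Euc n) - p.1‖ ^ 2) := by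
              gcongr; linarith
            nlinarith
          · rw [indicator_of_notMem hp]; simp
  have hc : 0 < rexp (-(1/2)) * δ := by positivity
  rw [← ENNReal.ofReal_mul (Real.exp_pos _).le] at hle
  rw [← ENNReal.le_div_iff_mul_le (Or.inl (by simpa using hc))
    (Or.inl ENNReal.ofReal_ne_top), ← ENNReal.ofReal_div_of_pos hc] at hle
  refine hle.trans (ENNReal.ofReal_le_ofReal (le_of_eq ?_))
  rw [Real.div_rpow (by positivity) hb0.le, Real.exp_neg]
  have : b ^ (-((n : ℝ) - 1) / 2) = (b ^ ((n:ℝ)/2))⁻¹ * δ⁻¹ := by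
    rw [hδ, ← Real.rpow_neg hb0.le, ← Real.rpow_neg hb0.le, ← Real.rpow_add hb0]
    congr 1; ring
  rw [this]
  field_simp

/-- Conjugate Fourier extension of `h`. -/
def extF {n : ℕ} (h : Sph n → ℂ) (r : ℝ) (ξ : Euc n) : ℂ :=
  ∫ ω : Sph n, (starRingEnd ℂ) (h ω) *
    Complex.exp (2 * π * Complex.I * r * (⟪(ω : Euc n), ξ⟫ : ℝ)) ∂(sigS n)

lemma norm_osc (r x : ℝ) : ‖Complex.exp (2 * π * Complex.I * r * (x : ℝ))‖ = 1 := by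
  have : 2 * π * Complex.I * r * (x : ℝ) = ((2 * π * r * x : ℝ) : ℂ) * Complex.I := by
    push_cast; ring
  rw [this, Complex.norm_exp_ofReal_mul_I]

lemma bdd_h {n : ℕ} (h : Sph n → ℂ) (hh : Continuous h) : ∃ M, 0 ≤ M ∧ ∀ ω, ‖h ω‖ ≤ M := by
  obtain ⟨M, hM⟩ := isCompact_univ.exists_bound_of_continuousOn hh.continuousOn
  exact ⟨max M 0, le_max_right _ _, fun ω => (hM ω (mem_univ _)).trans (le_max_left _ _)⟩

lemma cont_integrable {X : Type*} [TopologicalSpace X] [CompactSpace X] [T2Space X] [MeasurableSpace X]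
    [BorelSpace X] [SecondCountableTopology X]
    {E : Type*} [NormedAddCommGroup E]
    (μ : Measure X) [IsFiniteMeasure μ] (f : X → E) (hf : Continuous f) : Integrable f μ := by
  rw [← integrableOn_univ]
  exact hf.continuousOn.integrableOn_compact isCompact_univ

lemma extF_continuous {n : ℕ} (h : Sph n → ℂ) (hh : Continuous h) (r : ℝ) :
    Continuous (extF h r) := by
  obtain ⟨M, hM0, hM⟩ := bdd_h h hh
  apply continuous_of_dominated (bound := fun _ => M)
  · intro ξ
    apply Continuous.aestronglyMeasurable
    fun_prop
  · intro ξ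
    refine ae_of_all _ fun ω => ?_
    rw [norm_mul, norm_osc, mul_one, RCLike.norm_conj]; exact hM ω
  · exact integrable_const _
  · refine ae_of_all _ fun ω => ?_
    fun_prop

lemma energy_id {n : ℕ} (h : Sph n → ℂ) (hh : Continuous h) (r a : ℝ) (ha : 0 < a) :
    Integrable (fun ξ : Euc n => rexp (-a * ‖ξ‖ ^ 2) * ‖extF h r ξ‖ ^ 2) ∧
    ((∫ ξ : Euc n, rexp (-a * ‖ξ‖ ^ 2) * ‖extF h r ξ‖ ^ 2 : ℝ) : ℂ) =
      ∫ p : Sph n × Sph n, (starRingEnd ℂ) (h p.1) * h p.2 *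
        (((π / a) ^ ((n : ℝ) / 2) *
          rexp (-(π ^ 2 * r ^ 2 / a) * ‖(p.1 : Euc n) - p.2‖ ^ 2) : ℝ) : ℂ)
        ∂((sigS n).prod (sigS n)) := by
  obtain ⟨M, hM0, hM⟩ := bdd_h h hh
  have hG : Integrable (fun ξ : Euc n => rexp (-a * ‖ξ‖ ^ 2)) := by
    have hi := GaussianFourier.integral_rexp_neg_mul_sq_norm (V := Euc n) ha
    apply Integrable.of_integral_ne_zero
    rw [hi]; positivity
  let Φ : Euc n → Sph n × Sph n → ℂ := fun ξ p => (starRingEnd ℂ) (h p.1) * h p.2 *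
    Complex.exp (-(a : ℂ) * ‖ξ‖ ^ 2 + (2 * π * Complex.I * r) * (⟪(p.1 : Euc n) - p.2, ξ⟫ : ℝ))
  have hΦ : Integrable (Function.uncurry Φ) (volume.prod ((sigS n).prod (sigS n))) := by
    have hdom : Integrable (fun q : Euc n × (Sph n × Sph n) => M ^ 2 * rexp (-a * ‖q.1‖ ^ 2))
        (volume.prod ((sigS n).prod (sigS n))) := (hG.const_mul (M ^ 2)).comp_fst _
    refine hdom.mono' ?_ (ae_of_all _ ?_)
    · apply Continuous.aestronglyMeasurable
      simp only [Φ, Function.uncurry_def]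
      fun_prop
    · rintro ⟨ξ, p⟩
      simp only [Φ, Function.uncurry_apply_pair]
      rw [Complex.exp_add, norm_mul, norm_mul, norm_mul, norm_osc, RCLike.norm_conj, mul_one,
        Complex.norm_exp]
      have e : (-(a : ℂ) * (‖ξ‖ : ℂ) ^ 2).re = -a * ‖ξ‖ ^ 2 := by norm_cast
      rw [e, sq M]
      exact mul_le_mul_of_nonneg_right (mul_le_mul (hM _) (hM _) (norm_nonneg _) hM0)
        (Real.exp_pos _).le
  have h1 : ∀ ξ, ((rexp (-a * ‖ξ‖ ^ 2) * ‖extF h r ξ‖ ^ 2 : ℝ) : ℂ) =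
      ∫ p, Φ ξ p ∂((sigS n).prod (sigS n)) := by
    intro ξ
    have e1 : ((‖extF h r ξ‖ ^ 2 : ℝ) : ℂ) = extF h r ξ * (starRingEnd ℂ) (extF h r ξ) := by
      rw [Complex.mul_conj, Complex.normSq_eq_norm_sq]
    rw [Complex.ofReal_mul, e1]
    conv_lhs => rw [extF, ← integral_conj, ← integral_prod_mul, ← integral_const_mul]
    refine integral_congr_ae (ae_of_all _ fun p => ?_)
    simp only [Φ]
    rw [map_mul, Complex.conj_conj, ← Complex.exp_conj, inner_sub_left, Complex.exp_add]
    have : (2 * π * Complex.I * r) * ((⟪(p.1 : Euc n), ξ⟫ - ⟪(p.2 : Euc n), ξ⟫ : ℝ) : ℂ) =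
      2 * π * Complex.I * r * (⟪(p.1 : Euc n), ξ⟫ : ℝ) +
       (starRingEnd ℂ) (2 * π * Complex.I * r * (⟪(p.2 : Euc n), ξ⟫ : ℝ)) := by
      have h2 : (starRingEnd ℂ) (2 : ℂ) = 2 := Complex.conj_ofNat 2
      simp only [map_mul, Complex.conj_ofReal, Complex.conj_I, h2, Complex.ofReal_sub]
      ring
    rw [this, Complex.exp_add]
    push_cast
    ring
  constructor
  · have := hΦ.integral_prod_left
    simp only [Function.uncurry_apply_pair, ← h1] at this
    exact this.re
  · rw [← integral_complex_ofReal]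
    simp_rw [h1]
    rw [integral_integral_swap hΦ]
    refine integral_congr_ae (ae_of_all _ fun p => ?_)
    simp only [Φ]
    rw [integral_const_mul, GaussianFourier.integral_cexp_neg_mul_sq_norm_add (by simpa using ha)]
    congr 1
    push_cast
    rw [Complex.ofReal_cpow (by positivity)]
    congr 1
    · simp
    · congr 1
      have ha' : (a : ℂ) ≠ 0 := by exact_mod_cast ha.ne'
      field_simp
      ring_nf
      simp

lemma energy_bound {n : ℕ} (h : Sph n → ℂ) (hh : Continuous h) (r a G : ℝ) (ha : 0 < a)
    (hG : ∀ ω : Sph n, ∫ ω' : Sph n, rexp (-(π ^ 2 * r ^ 2 / a) * ‖(ω : Euc n) - ω'‖ ^ 2)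
      ∂(sigS n) ≤ G) :
    ∫ ξ : Euc n, rexp (-a * ‖ξ‖ ^ 2) * ‖extF h r ξ‖ ^ 2 ≤
      (π / a) ^ ((n : ℝ) / 2) * (G * ∫ ω, ‖h ω‖ ^ 2 ∂(sigS n)) := by
  have hid := (energy_id h hh r a ha).2
  set k : Euc n → ℝ := fun x => rexp (-(π ^ 2 * r ^ 2 / a) * ‖x‖ ^ 2) with hk
  have hkc : Continuous k := by rw [hk]; fun_prop
  have hnn : 0 ≤ ∫ ξ : Euc n, rexp (-a * ‖ξ‖ ^ 2) * ‖extF h r ξ‖ ^ 2 :=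
    integral_nonneg fun ξ => by positivity
  have hB1 : ∫ p : Sph n × Sph n, ‖h p.1‖ ^ 2 * k ((p.1 : Euc n) - p.2)
      ∂((sigS n).prod (sigS n)) ≤ G * ∫ ω, ‖h ω‖ ^ 2 ∂(sigS n) := by
    rw [integral_prod _ (cont_integrable _ _ (by fun_prop)), ← integral_const_mul]
    refine integral_mono_of_nonneg (ae_of_all _ fun ω => ?_) (cont_integrable _ _ (by fun_prop))
      (ae_of_all _ fun ω => ?_)
    · exact integral_nonneg fun ω' => by simp only [hk]; positivity
    · simp only
      rw [integral_const_mul, mul_comm]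
      gcongr
      exact hG ω
  have hB2 : ∫ p : Sph n × Sph n, ‖h p.2‖ ^ 2 * k ((p.1 : Euc n) - p.2)
      ∂((sigS n).prod (sigS n)) ≤ G * ∫ ω, ‖h ω‖ ^ 2 ∂(sigS n) := by
    rw [← integral_prod_swap]
    refine le_trans (le_of_eq ?_) hB1
    refine integral_congr_ae (ae_of_all _ fun p => ?_)
    simp only [hk, Prod.fst_swap, Prod.snd_swap]
    rw [norm_sub_rev]
  calc _ = ‖((∫ ξ : Euc n, rexp (-a * ‖ξ‖ ^ 2) * ‖extF h r ξ‖ ^ 2 : ℝ) : ℂ)‖ := by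
        rw [Complex.norm_real, Real.norm_of_nonneg hnn]
    _ ≤ ∫ p : Sph n × Sph n, (π / a) ^ ((n : ℝ) / 2) * (1/2) *
         (‖h p.1‖ ^ 2 * k ((p.1 : Euc n) - p.2) + ‖h p.2‖ ^ 2 * k ((p.1 : Euc n) - p.2))
         ∂((sigS n).prod (sigS n)) := by
        rw [hid]
        refine norm_integral_le_of_norm_le (cont_integrable _ _ (by fun_prop))
          (ae_of_all _ fun p => ?_)
        have hkp : 0 ≤ k ((p.1 : Euc n) - p.2) := by simp only [hk]; positivity
        have hpa : 0 ≤ (π / a) ^ ((n : ℝ) / 2) := by positivity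
        rw [norm_mul, norm_mul, RCLike.norm_conj, Complex.norm_real,
          Real.norm_of_nonneg (mul_nonneg hpa hkp)]
        have := mul_nonneg (mul_nonneg hpa hkp) (sq_nonneg (‖h p.1‖ - ‖h p.2‖))
        change _ * (_ * k ((p.1 : Euc n) - p.2)) ≤ _
        nlinarith
    _ = (π / a) ^ ((n : ℝ) / 2) * (1/2) *
          ((∫ p : Sph n × Sph n, ‖h p.1‖ ^ 2 * k ((p.1 : Euc n) - p.2)
            ∂((sigS n).prod (sigS n))) +
          ∫ p : Sph n × Sph n, ‖h p.2‖ ^ 2 * k ((p.1 : Euc n) - p.2)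
            ∂((sigS n).prod (sigS n))) := by
        rw [integral_const_mul, integral_add (cont_integrable _ _ (by fun_prop))
          (cont_integrable _ _ (by fun_prop))]
    _ ≤ (π / a) ^ ((n : ℝ) / 2) * (1/2) * (G * (∫ ω, ‖h ω‖ ^ 2 ∂(sigS n)) +
          G * ∫ ω, ‖h ω‖ ^ 2 ∂(sigS n)) := by gcongr
    _ = _ := by ring

lemma gauss_uniform {n : ℕ} (hn : 1 ≤ n) : ∃ K : ℝ, 0 < K ∧ ∀ t : ℝ, 0 < t → ∀ ω : Sph n,
    ∫ ω' : Sph n, rexp (-(π ^ 2 / t) * ‖(ω : Euc n) - ω'‖ ^ 2) ∂(sigS n) ≤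
      K * (if t ≤ 1 then t ^ (((n : ℝ) - 1) / 2) else 1) := by
  set K1 := rexp (1/2) * (2 * π) ^ ((n : ℝ) / 2) with hK1
  have hK1p : 0 < K1 := by positivity
  set m := (sigS n).real univ with hm
  have hm0 : 0 ≤ m := measureReal_nonneg
  have hn' : (1 : ℝ) ≤ n := by exact_mod_cast hn
  refine ⟨K1 + m, by positivity, fun t ht ω => ?_⟩
  have hp3 := Real.pi_gt_three
  split_ifs with h1
  · have hb : 1 ≤ π ^ 2 / t := by
      rw [le_div_iff₀ ht]; nlinarith
    have := gauss_sphere hn _ hb ω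
    rw [← ofReal_integral_eq_lintegral_ofReal (cont_integrable _ _ (by fun_prop))
      (ae_of_all _ fun x => (Real.exp_pos _).le),
      ENNReal.ofReal_le_ofReal_iff (by positivity)] at this
    refine this.trans ?_
    have h2 : (π ^ 2 / t) ^ (-((n : ℝ) - 1) / 2) ≤ t ^ (((n : ℝ) - 1) / 2) := by
      rw [neg_div, Real.rpow_neg (by positivity), ← Real.inv_rpow (by positivity)]
      apply Real.rpow_le_rpow (by positivity)
      · rw [inv_div, div_le_iff₀ (by positivity)]
        exact le_mul_of_one_le_right ht.le (by nlinarith)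
      · linarith
    gcongr
    linarith
  · calc _ ≤ ∫ ω' : Sph n, (1 : ℝ) ∂(sigS n) := by
          refine integral_mono (cont_integrable _ _ (by fun_prop)) (integrable_const _) fun x => ?_
          simp only
          rw [Real.exp_le_one_iff, neg_mul, neg_nonpos]
          positivity
      _ = m := by simp [hm]
      _ ≤ _ := by linarith

lemma J_integrable (n s : ℝ) (hs1 : 1/2 < s) (hs2 : s < n / 2) :
    IntegrableOn (fun t : ℝ => t ^ (s - 1 - n / 2) *
      (if t ≤ 1 then t ^ ((n - 1) / 2) else 1)) (Ioi 0) := by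
  rw [← Ioc_union_Ioi_eq_Ioi (zero_le_one (α := ℝ))]
  refine IntegrableOn.union ?_ ?_
  · have h : IntegrableOn (fun t : ℝ => t ^ (s - 3/2)) (Ioc 0 1) := by
      rw [← intervalIntegrable_iff_integrableOn_Ioc_of_le zero_le_one]
      apply intervalIntegral.intervalIntegrable_rpow'
      linarith
    refine h.congr_fun (fun t ht => ?_) measurableSet_Ioc
    simp only [ht.2, if_true]
    rw [← Real.rpow_add ht.1]
    congr 1; ring
  · have h : IntegrableOn (fun t : ℝ => t ^ (s - 1 - n/2)) (Ioi 1) :=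
      integrableOn_Ioi_rpow_of_lt (by linarith) one_pos
    refine h.congr_fun (fun t ht => ?_) measurableSet_Ioi
    simp [not_le.2 (mem_Ioi.1 ht)]

lemma riesz_rep (s : ℝ) (hs : 0 < s) (x r : ℝ) (hx : 0 < x) (hr : 0 < r) :
    ENNReal.ofReal (x ^ (-(2 * s))) = ENNReal.ofReal (r ^ (2 * s) / Real.Gamma s) *
      ∫⁻ t in Ioi (0 : ℝ), ENNReal.ofReal (t ^ (s - 1)) *
        ENNReal.ofReal (rexp (-(t * r ^ 2) * x ^ 2)) := by
  have hpos : 0 < r ^ 2 * x ^ 2 := by positivity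
  have h := Real.integral_rpow_mul_exp_neg_mul_Ioi hs hpos
  have hΓ := Real.Gamma_pos_of_pos hs
  have hI : IntegrableOn (fun t : ℝ => t ^ (s - 1) * rexp (-(r ^ 2 * x ^ 2 * t))) (Ioi 0) := by
    apply Integrable.of_integral_ne_zero
    rw [h]; positivity
  have e : ∫⁻ t in Ioi (0 : ℝ), ENNReal.ofReal (t ^ (s - 1)) *
        ENNReal.ofReal (rexp (-(t * r ^ 2) * x ^ 2)) =
      ENNReal.ofReal (∫ t in Ioi (0 : ℝ), t ^ (s - 1) * rexp (-(r ^ 2 * x ^ 2 * t))) := by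
    rw [ofReal_integral_eq_lintegral_ofReal hI]
    · refine setLIntegral_congr_fun measurableSet_Ioi fun t ht => ?_
      rw [← ENNReal.ofReal_mul (Real.rpow_nonneg (le_of_lt ht) _)]
      congr 3; ring
    · refine (ae_restrict_mem measurableSet_Ioi).mono fun t ht => ?_
      have : 0 < t := ht
      change (0 : ℝ) ≤ t ^ (s - 1) * rexp (-(r ^ 2 * x ^ 2 * t))
      positivity
  rw [e, h, ← ENNReal.ofReal_mul (by positivity)]
  congr 1
  rw [one_div, Real.inv_rpow hpos.le, Real.mul_rpow (by positivity) (by positivity),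
    ← Real.rpow_natCast, ← Real.rpow_natCast, ← Real.rpow_mul hr.le, ← Real.rpow_mul hx.le,
    Real.rpow_neg hx.le]
  push_cast
  field_simp

lemma potential {n : ℕ} (hn : 1 ≤ n) (s : ℝ) (hs1 : 1/2 < s) (hs2 : s < (n : ℝ) / 2) :
    ∃ K : ℝ, 0 < K ∧ ∀ (h : Sph n → ℂ), Continuous h → ∀ r : ℝ, 0 < r →
      ∫⁻ ξ : Euc n, ENNReal.ofReal (‖ξ‖ ^ (-(2 * s))) * ENNReal.ofReal (‖extF h r ξ‖ ^ 2) ≤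
        ENNReal.ofReal (K * r ^ (2 * s - n) * ∫ ω, ‖h ω‖ ^ 2 ∂(sigS n)) := by
  have hne : Nonempty (Fin n) := ⟨⟨0, hn⟩⟩
  obtain ⟨K0, hK0, hG⟩ := gauss_uniform hn
  have hJ := J_integrable n s hs1 hs2
  set g : ℝ → ℝ := fun t => if t ≤ 1 then t ^ (((n : ℝ) - 1) / 2) else 1 with hg
  have hg0 : ∀ t, 0 < t → 0 ≤ g t := by
    intro t ht; simp only [hg]; split_ifs <;> positivity
  set J := ∫ t in Ioi (0 : ℝ), t ^ (s - 1 - (n : ℝ) / 2) * g t with hJd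
  have hJ0 : 0 ≤ J := setIntegral_nonneg measurableSet_Ioi fun t ht =>
    mul_nonneg (Real.rpow_nonneg (le_of_lt ht) _) (hg0 t ht)
  have hs0 : 0 < s := by linarith
  have hΓ := Real.Gamma_pos_of_pos hs0
  refine ⟨1 / Real.Gamma s * (π ^ ((n : ℝ) / 2) * K0) * (J + 1), by positivity,
    fun h hh r hr => ?_⟩
  set B := ∫ ω, ‖h ω‖ ^ 2 ∂(sigS n) with hB
  have hB0 : 0 ≤ B := integral_nonneg fun ω => by positivity
  have hFc := extF_continuous h hh r
  have hFm : Measurable (extF h r) := hFc.measurable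
  set c := ENNReal.ofReal (r ^ (2 * s) / Real.Gamma s) with hc
  calc _ = ∫⁻ ξ : Euc n, c * ∫⁻ t in Ioi (0 : ℝ), ENNReal.ofReal (t ^ (s - 1)) *
        ENNReal.ofReal (rexp (-(t * r ^ 2) * ‖ξ‖ ^ 2) * ‖extF h r ξ‖ ^ 2) := by
        have h0 : ∀ᵐ ξ : Euc n, ξ ≠ 0 := by
          rw [ae_iff]; simp
        refine lintegral_congr_ae (h0.mono fun ξ hξ => ?_)
        simp only
        rw [riesz_rep s hs0 ‖ξ‖ r (norm_pos_iff.2 hξ) hr, mul_assoc, ← lintegral_mul_const _ (by fun_prop)]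
        congr 1
        refine lintegral_congr fun t => ?_
        rw [mul_assoc, ← ENNReal.ofReal_mul (Real.exp_pos _).le]
    _ = c * ∫⁻ t in Ioi (0 : ℝ), ENNReal.ofReal (t ^ (s - 1)) *
          ∫⁻ ξ : Euc n, ENNReal.ofReal (rexp (-(t * r ^ 2) * ‖ξ‖ ^ 2) * ‖extF h r ξ‖ ^ 2) := by
        rw [lintegral_const_mul' _ _ ENNReal.ofReal_ne_top, lintegral_lintegral_swap]
        · congr 1
          refine lintegral_congr fun t => ?_
          rw [lintegral_const_mul' _ _ ENNReal.ofReal_ne_top]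
        · apply Measurable.aemeasurable
          simp only [Function.uncurry_def]
          fun_prop
    _ ≤ c * ∫⁻ t in Ioi (0 : ℝ), ENNReal.ofReal (π ^ ((n : ℝ) / 2) * K0 * r ^ (-(n : ℝ)) * B) *
          ENNReal.ofReal (t ^ (s - 1 - (n : ℝ) / 2) * g t) := by
        gcongr c * ?_
        refine setLIntegral_mono' measurableSet_Ioi fun t ht => ?_
        have ht0 : 0 < t := ht
        have hgt := hg0 t ht
        have hap : 0 < t * r ^ 2 := by positivity
        rw [← ofReal_integral_eq_lintegral_ofReal (energy_id h hh r _ hap).1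
          (ae_of_all _ fun ξ => by positivity), ← ENNReal.ofReal_mul (by positivity),
          ← ENNReal.ofReal_mul (by positivity)]
        apply ENNReal.ofReal_le_ofReal
        have hE := energy_bound h hh r (t * r ^ 2) (K0 * g t) hap (by
          intro ω
          have : π ^ 2 * r ^ 2 / (t * r ^ 2) = π ^ 2 / t := by field_simp
          rw [this]; exact hG t ht0 ω)
        calc _ ≤ t ^ (s - 1) * ((π / (t * r ^ 2)) ^ ((n : ℝ) / 2) * (K0 * g t * B)) := by gcongr
          _ = _ := by
            rw [Real.div_rpow (by positivity) (by positivity),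
              Real.mul_rpow (by positivity) (by positivity), ← Real.rpow_natCast r,
              ← Real.rpow_mul hr.le, Real.rpow_neg hr.le, Real.rpow_sub ht0 (s - 1)]
            have : ((2 : ℕ) : ℝ) * ((n : ℝ) / 2) = n := by push_cast; ring
            rw [this]
            field_simp
    _ = ENNReal.ofReal (r ^ (2 * s) / Real.Gamma s *
          (π ^ ((n : ℝ) / 2) * K0 * r ^ (-(n : ℝ)) * B * J)) := by
        rw [lintegral_const_mul' _ _ ENNReal.ofReal_ne_top,
          ← ofReal_integral_eq_lintegral_ofReal hJ, ← ENNReal.ofReal_mul (by positivity), hc,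
          ← ENNReal.ofReal_mul (by positivity)]
        refine (ae_restrict_mem measurableSet_Ioi).mono fun t ht => ?_
        exact mul_nonneg (Real.rpow_nonneg (le_of_lt ht) _) (hg0 t ht)
    _ ≤ _ := by
        apply ENNReal.ofReal_le_ofReal
        rw [sub_eq_add_neg, Real.rpow_add hr]
        have : r ^ (2 * s) / Real.Gamma s *
          (π ^ ((n : ℝ) / 2) * K0 * r ^ (-(n : ℝ)) * B * J) =
          1 / Real.Gamma s * (π ^ ((n : ℝ) / 2) * K0) * J * (r ^ (2 * s) * r ^ (-(n:ℝ))) * B := by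
          ring
        rw [this]
        gcongr
        linarith

lemma trace_id {n : ℕ} (v : SchwartzMap (Euc n) ℂ) (r : ℝ) :
    ((∫ ω : Sph n, ‖v (r • (ω : Euc n))‖ ^ 2 ∂(sigS n) : ℝ) : ℂ) =
      ∫ ξ : Euc n, 𝓕 (v : Euc n → ℂ) ξ * extF (fun ω : Sph n => v (r • (ω : Euc n))) r ξ := by
  set h : Sph n → ℂ := fun ω => v (r • (ω : Euc n)) with hh
  have hc : Continuous h := by have := v.continuous; rw [hh]; fun_prop
  obtain ⟨M, hM0, hM⟩ := bdd_h h hc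
  set w : SchwartzMap (Euc n) ℂ := 𝓕 v with hw
  have hwv : 𝓕 (v : Euc n → ℂ) = (w : Euc n → ℂ) := by rw [hw, SchwartzMap.fourier_coe]
  have hwc := w.continuous
  have hwi : Integrable w volume := w.integrable
  let Φ : Sph n → Euc n → ℂ := fun ω ξ => w ξ * ((starRingEnd ℂ) (h ω) *
    Complex.exp (2 * π * Complex.I * r * (⟪(ω : Euc n), ξ⟫ : ℝ)))
  have hΦ : Integrable (Function.uncurry Φ) ((sigS n).prod volume) := by
    have hdom : Integrable (fun q : Sph n × Euc n => M * ‖w q.2‖)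
        ((sigS n).prod volume) := (hwi.norm.const_mul M).comp_snd _
    refine hdom.mono' ?_ (ae_of_all _ ?_)
    · apply Continuous.aestronglyMeasurable
      simp only [Φ, Function.uncurry_def]
      fun_prop
    · rintro ⟨ω, ξ⟩
      simp only [Φ, Function.uncurry_apply_pair]
      rw [norm_mul, norm_mul, norm_osc, RCLike.norm_conj, mul_one, mul_comm]
      gcongr
      exact hM _
  have hinv : ∀ x : Euc n, v x = ∫ ξ : Euc n,
      Complex.exp ((2 * π * ⟪ξ, x⟫ : ℝ) * Complex.I) * w ξ := by
    intro x
    have h1 : 𝓕⁻ (𝓕 (v : Euc n → ℂ)) = v :=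
      v.continuous.fourierInv_fourier_eq v.integrable (by rw [hwv]; exact hwi)
    rw [← congrFun h1 x, hwv, Real.fourierInv_eq']
    simp
  rw [← integral_complex_ofReal, hwv]
  calc _ = ∫ ω, (∫ ξ : Euc n, Φ ω ξ) ∂(sigS n) := by
        refine integral_congr_ae (ae_of_all _ fun ω => ?_)
        simp only [Φ]
        have e1 : ((‖h ω‖ ^ 2 : ℝ) : ℂ) = (starRingEnd ℂ) (h ω) * h ω := by
          rw [mul_comm, Complex.mul_conj, Complex.normSq_eq_norm_sq]
        change ((‖h ω‖ ^ 2 : ℝ) : ℂ) = _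
        rw [e1]
        conv_lhs => rw [hh]
        simp only
        conv_lhs => arg 2; rw [hinv]
        rw [← integral_const_mul]
        refine integral_congr_ae (ae_of_all _ fun ξ => ?_)
        simp only [hh]
        have e2 : ((2 * π * ⟪ξ, r • (ω : Euc n)⟫ : ℝ) : ℂ) * Complex.I =
            2 * π * Complex.I * r * (⟪(ω : Euc n), ξ⟫ : ℝ) := by
          rw [inner_smul_right, real_inner_comm]; push_cast; ring
        rw [e2]; ring
    _ = ∫ ξ : Euc n, ∫ ω, Φ ω ξ ∂(sigS n) := integral_integral_swap hΦ
    _ = _ := by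
        refine integral_congr_ae (ae_of_all _ fun ξ => ?_)
        simp only [Φ, extF]
        rw [integral_const_mul]

lemma sob_integrable {n : ℕ} (s : ℝ) (hs : 0 < s) (w : SchwartzMap (Euc n) ℂ) :
    Integrable (fun ξ : Euc n => ‖ξ‖ ^ (2 * s) * ‖w ξ‖ ^ 2) := by
  obtain ⟨k, hk⟩ := exists_nat_ge (2 * s)
  obtain ⟨M, hM⟩ : ∃ M : ℝ, ∀ x, ‖w x‖ ≤ M := by
    obtain ⟨M, hM⟩ := w.decay 0 0
    exact ⟨M, fun x => by simpa using hM.2 x⟩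
  have hdom := ((w.integrable (μ := volume)).norm.add (w.integrable_pow_mul volume k)).const_mul M
  have hwc := w.continuous
  refine hdom.mono' ?_ (ae_of_all _ fun ξ => ?_)
  · apply Continuous.aestronglyMeasurable
    exact ((continuous_norm.rpow_const fun _ => Or.inr (by linarith))).mul (by fun_prop)
  · have hξ := norm_nonneg ξ
    have hp : ‖ξ‖ ^ (2 * s) ≤ 1 + ‖ξ‖ ^ k := by
      rcases le_total ‖ξ‖ 1 with h1 | h1
      · have := Real.rpow_le_one hξ h1 (by linarith : 0 ≤ 2 * s)
        have : 0 ≤ ‖ξ‖ ^ k := by positivity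
        linarith
      · have := Real.rpow_le_rpow_of_exponent_le h1 hk
        rw [Real.rpow_natCast] at this
        linarith
    rw [Real.norm_of_nonneg (by positivity)]
    simp only [Pi.add_apply]
    have hw0 := norm_nonneg (w ξ)
    calc _ ≤ (1 + ‖ξ‖ ^ k) * (M * ‖w ξ‖) := by
          rw [sq]; gcongr; exact hM ξ
      _ = _ := by ring

lemma trace_sq {n : ℕ} (s K r : ℝ) (hs : 0 < s) (hr : 0 < r) (hK : 0 < K)
    (v : SchwartzMap (Euc n) ℂ) (hn : 1 ≤ n)
    (hpot : ∫⁻ ξ : Euc n, ENNReal.ofReal (‖ξ‖ ^ (-(2 * s))) *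
        ENNReal.ofReal (‖extF (fun ω : Sph n => v (r • (ω : Euc n))) r ξ‖ ^ 2) ≤
        ENNReal.ofReal (K * r ^ (2 * s - n) *
          ∫ ω : Sph n, ‖v (r • (ω : Euc n))‖ ^ 2 ∂(sigS n))) :
    ∫ ω : Sph n, ‖v (r • (ω : Euc n))‖ ^ 2 ∂(sigS n) ≤
      K * r ^ (2 * s - n) * ∫ ξ : Euc n, ‖ξ‖ ^ (2 * s) * ‖𝓕 (v : Euc n → ℂ) ξ‖ ^ 2 := by
  have hne : Nonempty (Fin n) := ⟨⟨0, hn⟩⟩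
  have hid := trace_id v r
  set h : Sph n → ℂ := fun ω => v (r • (ω : Euc n)) with hh
  have hc : Continuous h := by have := v.continuous; rw [hh]; fun_prop
  have hFm : Measurable (extF h r) := (extF_continuous h hc r).measurable
  set w : SchwartzMap (Euc n) ℂ := 𝓕 v with hw
  have hwv : 𝓕 (v : Euc n → ℂ) = (w : Euc n → ℂ) := by rw [hw, SchwartzMap.fourier_coe]
  rw [hwv] at hid ⊢
  have hwm : Measurable w := w.continuous.measurable
  set B := ∫ ω : Sph n, ‖v (r • (ω : Euc n))‖ ^ 2 ∂(sigS n) with hB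
  have hB0 : 0 ≤ B := integral_nonneg fun ω => by positivity
  have hI := sob_integrable s hs w
  set H := ∫ ξ : Euc n, ‖ξ‖ ^ (2 * s) * ‖w ξ‖ ^ 2 with hH
  have hH0 : 0 ≤ H := integral_nonneg fun ω => by positivity
  set P := K * r ^ (2 * s - n) with hP
  have hP0 : 0 < P := by positivity
  have key : ENNReal.ofReal B ≤ ENNReal.ofReal H ^ (1/2 : ℝ) * ENNReal.ofReal (P * B) ^ (1/2 : ℝ) := by
    calc ENNReal.ofReal B = ‖((B : ℝ) : ℂ)‖ₑ := by
          rw [← ofReal_norm, Complex.norm_real, Real.norm_of_nonneg hB0]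
      _ ≤ ∫⁻ ξ, ‖w ξ * extF h r ξ‖ₑ := by
          rw [hid]; exact enorm_integral_le_lintegral_enorm _
      _ = ∫⁻ ξ, ((fun ξ : Euc n => ENNReal.ofReal (‖ξ‖ ^ s * ‖w ξ‖)) *
            (fun ξ : Euc n => ENNReal.ofReal (‖ξ‖ ^ (-s) * ‖extF h r ξ‖))) ξ := by
          have h0 : ∀ᵐ ξ : Euc n, ξ ≠ 0 := by
            rw [ae_iff]; simp
          refine lintegral_congr_ae (h0.mono fun ξ hξ => ?_)
          have hx := norm_pos_iff.2 hξ
          simp only [Pi.mul_apply]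
          rw [← ofReal_norm, ← ENNReal.ofReal_mul (by positivity), norm_mul, Real.rpow_neg hx.le]
          congr 1
          have : 0 < ‖ξ‖ ^ s := by positivity
          field_simp
      _ ≤ (∫⁻ ξ : Euc n, ENNReal.ofReal (‖ξ‖ ^ s * ‖w ξ‖) ^ (2 : ℝ)) ^ (1/2 : ℝ) *
          (∫⁻ ξ : Euc n, ENNReal.ofReal (‖ξ‖ ^ (-s) * ‖extF h r ξ‖) ^ (2 : ℝ)) ^ (1/2 : ℝ) := by
          apply ENNReal.lintegral_mul_le_Lp_mul_Lq volume Real.HolderConjugate.two_two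
          · fun_prop
          · fun_prop
      _ ≤ _ := by
          have sqr : ∀ x : ℝ, 0 ≤ x → ∀ y : ℝ, 0 ≤ y → ∀ q : ℝ,
              ENNReal.ofReal (x ^ q * y) ^ (2 : ℝ) = ENNReal.ofReal (x ^ (2 * q) * y ^ 2) := by
            intro x hx y hy q
            rw [ENNReal.ofReal_rpow_of_nonneg (by positivity) (by norm_num),
              Real.mul_rpow (by positivity) hy, ← Real.rpow_mul hx, mul_comm q]
            norm_num
          gcongr
          · rw [hH, ofReal_integral_eq_lintegral_ofReal hI (ae_of_all _ fun ξ => by positivity)]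
            refine le_of_eq (lintegral_congr fun ξ => ?_)
            rw [sqr _ (norm_nonneg _) _ (norm_nonneg _)]
          · refine le_trans (le_of_eq (lintegral_congr fun ξ => ?_)) hpot
            rw [sqr _ (norm_nonneg _) _ (norm_nonneg _), ENNReal.ofReal_mul (by positivity)]
            congr 3
            ring
  rw [ENNReal.ofReal_rpow_of_nonneg hH0 (by norm_num),
    ENNReal.ofReal_rpow_of_nonneg (by positivity) (by norm_num),
    ← ENNReal.ofReal_mul (by positivity), ENNReal.ofReal_le_ofReal_iff (by positivity),
    ← Real.mul_rpow hH0 (by positivity), ← Real.sqrt_eq_rpow] at key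
  have h2 := (Real.le_sqrt hB0 (by positivity)).1 key
  rcases hB0.eq_or_lt with h0 | h0
  · rw [← h0]; positivity
  · nlinarith

/-- (Trace lemma) For `n ≥ 2` and `1/2 < s < n/2` there is `C` such that for all
Schwartz `v` and all `r > 0`,
`r^{n/2-s} ‖v(r·)‖_{L²(S^{n-1})} ≤ C ‖v‖_{Ḣˢ}`. -/
theorem stmt2 (n : ℕ) (hn : 2 ≤ n) (s : ℝ) (hs1 : 1/2 < s) (hs2 : s < (n : ℝ) / 2) :
    ∃ C > 0, ∀ v : SchwartzMap (Euc n) ℂ, ∀ r : ℝ, 0 < r →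
      r ^ ((n : ℝ) / 2 - s) * sphL2 (fun x => v x) r ≤ C * hSob n s (fun x => v x) := by
  obtain ⟨K, hK, hpot⟩ := potential (by omega : 1 ≤ n) s hs1 hs2
  have hs : 0 < s := by linarith
  refine ⟨K ^ (1/2 : ℝ), by positivity, fun v r hr => ?_⟩
  have hc : Continuous fun ω : Sph n => v (r • (ω : Euc n)) := by
    have := v.continuous
    fun_prop
  have h1 := trace_sq s K r hs hr hK v (by omega) (hpot _ hc r hr)
  unfold sphL2 hSob
  have hB0 : 0 ≤ ∫ ω : Sph n, ‖v (r • (ω : Euc n))‖ ^ 2 ∂(sigS n) :=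
    integral_nonneg fun ω => by positivity
  have hH0 : 0 ≤ ∫ ξ : Euc n, ‖ξ‖ ^ (2 * s) * ‖𝓕 (v : Euc n → ℂ) ξ‖ ^ 2 :=
    integral_nonneg fun ω => by positivity
  have e1 : r ^ ((n : ℝ) / 2 - s) = (r ^ ((n : ℝ) - 2 * s)) ^ (1/2 : ℝ) := by
    rw [← Real.rpow_mul hr.le]; congr 1; ring
  rw [e1, ← Real.mul_rpow (by positivity) hB0, ← Real.mul_rpow hK.le hH0]
  refine Real.rpow_le_rpow (by positivity) ?_ (by norm_num)
  have e2 : r ^ ((n : ℝ) - 2 * s) * r ^ (2 * s - (n : ℝ)) = 1 := by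
    rw [← Real.rpow_add hr]; simp
  calc _ ≤ r ^ ((n : ℝ) - 2 * s) * (K * r ^ (2 * s - n) *
        ∫ ξ : Euc n, ‖ξ‖ ^ (2 * s) * ‖𝓕 (v : Euc n → ℂ) ξ‖ ^ 2) := by gcongr
    _ = (r ^ ((n : ℝ) - 2 * s) * r ^ (2 * s - (n : ℝ))) * (K *
        ∫ ξ : Euc n, ‖ξ‖ ^ (2 * s) * ‖𝓕 (v : Euc n → ℂ) ξ‖ ^ 2) := by ring
    _ = _ := by rw [e2, one_mul]

end
end

section
/- (Morawetz-type weighted $L^2$ estimate) For $n \ge 2$ and $1/2 < s < n/2$, there is a constant $C$ so that for all Schwartz $\varphi$ on $\mathbb{R}^n$, $\| |x|^{-s} e^{it|D|}\varphi \|_{L^2(\mathbb{R}_+ \times \mathbb{R}^n)} \le C \| |D|^{s-1/2}\varphi \|_{L^2(\mathbb{R}^n)}$. -/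
open MeasureTheory Real Set FourierTransform
open scoped RealInnerProductSpace

noncomputable section

open scoped ENNReal

lemma aux_polar {n : ℕ} (hn : 2 ≤ n) (f : Euc n → ℝ≥0∞) (hf : Measurable f) :
    ∫⁻ x, f x = ∫⁻ ω : Metric.sphere (0 : Euc n) 1, (∫⁻ ρ in Ioi (0:ℝ),
      ENNReal.ofReal (ρ ^ (n-1)) * f (ρ • (ω : Euc n))) ∂((volume : Measure (Euc n)).toSphere) := by
  have hnt : Nontrivial (Euc n) := by
    have : Nonempty (Fin n) := ⟨⟨0, by omega⟩⟩
    infer_instance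
  have h1 : ∫⁻ x, f x = ∫⁻ x : ({(0 : Euc n)}ᶜ : Set (Euc n)), f x ∂((volume : Measure (Euc n)).comap (↑)) := by
    rw [lintegral_subtype_comap (measurableSet_singleton _).compl f,
      restrict_compl_singleton]
  have hmp := (volume : Measure (Euc n)).measurePreserving_homeomorphUnitSphereProd
  have hd : Module.finrank ℝ (Euc n) = n := by simp
  rw [hd] at hmp
  have h2 := hmp.lintegral_comp_emb (Homeomorph.measurableEmbedding _)
    (fun p => f (p.2.1 • (p.1 : Euc n)))
  have h3 : ∀ x : ({(0 : Euc n)}ᶜ : Set (Euc n)),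
      ((homeomorphUnitSphereProd (Euc n)) x).2.1 • (((homeomorphUnitSphereProd (Euc n)) x).1 : Euc n) = x := by
    intro x
    have hx : ‖(x : Euc n)‖ ≠ 0 := norm_ne_zero_iff.2 x.2
    simp [smul_smul, hx]
  simp only [h3] at h2
  have hmeas : Measurable (fun p : (Metric.sphere (0 : Euc n) 1) × (Ioi (0:ℝ)) => f (p.2.1 • (p.1 : Euc n))) := by
    apply hf.comp
    fun_prop
  rw [h1, h2, lintegral_prod _ hmeas.aemeasurable]
  refine lintegral_congr fun ω => ?_
  rw [Measure.volumeIoiPow, lintegral_withDensity_eq_lintegral_mul _ (by fun_prop)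
    (by apply hf.comp; fun_prop)]
  simp only [Pi.mul_apply]
  rw [lintegral_subtype_comap measurableSet_Ioi (fun ρ : ℝ => ENNReal.ofReal (ρ ^ (n-1)) * f (ρ • (ω : Euc n)))]

lemma aux_gauss (n : ℕ) (e : Euc n) {b : ℝ} (hb : 0 < b) :
    ∫⁻ x : Euc n, ENNReal.ofReal (rexp (-(b * ‖x - e‖^2))) = ENNReal.ofReal ((π / b) ^ ((n:ℝ)/2)) := by
  rw [lintegral_sub_right_eq_self (fun x : Euc n => ENNReal.ofReal (rexp (-(b * ‖x‖^2)))) e]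
  have h := GaussianFourier.integral_rexp_neg_mul_sq_norm (V := Euc n) hb
  have hp : 0 < (π / b) ^ ((Module.finrank ℝ (Euc n) : ℝ)/2) := by positivity
  have hi : Integrable (fun v : Euc n => rexp (-b * ‖v‖^2)) :=
    .of_integral_ne_zero (by rw [h]; exact hp.ne')
  simp only [← neg_mul]
  rw [← ofReal_integral_eq_lintegral_ofReal hi (ae_of_all _ fun _ => (exp_pos _).le), h]
  simp

lemma aux_gauss1 (r : ℝ) {b : ℝ} (hb : 0 < b) :
    ∫⁻ x : ℝ, ENNReal.ofReal (rexp (-(b * (r - x)^2))) = ENNReal.ofReal (√(π / b)) := by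
  rw [lintegral_sub_left_eq_self (fun x : ℝ => ENNReal.ofReal (rexp (-(b * x^2)))) r]
  simp only [← neg_mul]
  rw [← ofReal_integral_eq_lintegral_ofReal (integrable_exp_neg_mul_sq hb)
    (ae_of_all _ fun _ => (exp_pos _).le), integral_gaussian]

lemma aux_sph (n : ℕ) (hn : 2 ≤ n) : ∃ C > 0, ∀ e : Euc n, ‖e‖ = 1 → ∀ b : ℝ, 0 < b →
    ∫⁻ ω : Metric.sphere (0 : Euc n) 1, ENNReal.ofReal (rexp (-(2 * b^2 * ‖(ω : Euc n) - e‖^2)))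
      ∂((volume : Measure (Euc n)).toSphere) ≤ ENNReal.ofReal (C * (1/b)^(n-1)) := by
  refine ⟨rexp 2 * π ^ ((n:ℝ)/2), by positivity, fun e he b hb => ?_⟩
  have hg := aux_gauss n e (b := b^2) (by positivity)
  rw [aux_polar hn _ (by fun_prop)] at hg
  have key : ∀ ω : Metric.sphere (0 : Euc n) 1,
      ENNReal.ofReal (rexp (-2) * (1/b)) * ENNReal.ofReal (rexp (-(2 * b^2 * ‖(ω : Euc n) - e‖^2))) ≤
      ∫⁻ ρ in Ioi (0:ℝ),
      ENNReal.ofReal (ρ ^ (n-1)) * ENNReal.ofReal (rexp (-(b^2 * ‖ρ • (ω : Euc n) - e‖^2))) := by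
    intro ω
    have hω : ‖(ω : Euc n)‖ = 1 := by simp
    calc _ = ∫⁻ ρ in Ioc (1:ℝ) (1 + 1/b), ENNReal.ofReal (rexp (-2)) *
          ENNReal.ofReal (rexp (-(2 * b^2 * ‖(ω : Euc n) - e‖^2))) := by
          rw [setLIntegral_const, Real.volume_Ioc, ENNReal.ofReal_mul (exp_pos _).le]
          simp only [add_sub_cancel_left]
          ring
      _ ≤ ∫⁻ ρ in Ioc (1:ℝ) (1 + 1/b), ENNReal.ofReal (ρ ^ (n-1)) * ENNReal.ofReal (rexp (-(b^2 * ‖ρ • (ω : Euc n) - e‖^2))) := by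
          refine setLIntegral_mono' measurableSet_Ioc fun ρ hρ => ?_
          have h1 : (1:ℝ) ≤ ρ ^ (n-1) := one_le_pow₀ hρ.1.le
          rw [← ENNReal.ofReal_mul (exp_pos _).le, ← ENNReal.ofReal_mul (by linarith), ← Real.exp_add]
          apply ENNReal.ofReal_le_ofReal
          have h2 : ‖ρ • (ω : Euc n) - e‖ ≤ (ρ - 1) + ‖(ω : Euc n) - e‖ := by
            have : ρ • (ω : Euc n) - e = (ρ - 1) • (ω : Euc n) + ((ω : Euc n) - e) := by module
            rw [this]
            refine (norm_add_le _ _).trans ?_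
            rw [norm_smul, hω, Real.norm_of_nonneg (by linarith [hρ.1]), mul_one]
          have h3 : ‖ρ • (ω : Euc n) - e‖^2 ≤ 2 * (ρ-1)^2 + 2 * ‖(ω : Euc n) - e‖^2 := by
            have := pow_le_pow_left₀ (norm_nonneg _) h2 2
            nlinarith [sq_nonneg ((ρ - 1) - ‖(ω : Euc n) - e‖)]
          have h4 : b * (ρ - 1) ≤ 1 := by
            have : ρ - 1 ≤ 1/b := by linarith [hρ.2]
            calc b * (ρ - 1) ≤ b * (1/b) := by gcongr
              _ = 1 := by field_simp
          have h5 : (b * (ρ - 1))^2 ≤ 1 := by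
            have : 0 ≤ b * (ρ-1) := mul_nonneg hb.le (by linarith [hρ.1])
            nlinarith
          have h6 : b^2 * ‖ρ • (ω : Euc n) - e‖^2 ≤ b^2 * (2 * (ρ-1)^2 + 2 * ‖(ω : Euc n) - e‖^2) := by gcongr
          calc _ ≤ rexp (-(b^2 * ‖ρ • (ω : Euc n) - e‖^2)) := by
                apply Real.exp_le_exp.2; nlinarith
            _ ≤ _ := le_mul_of_one_le_left (exp_pos _).le h1
      _ ≤ _ := lintegral_mono_set (fun x hx => lt_trans one_pos hx.1)
  have h7 := lintegral_mono (μ := (volume : Measure (Euc n)).toSphere) key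
  rw [hg, lintegral_const_mul _ (by fun_prop)] at h7
  have e1 : (π / b^2) ^ ((n:ℝ)/2) = π ^ ((n:ℝ)/2) * (1/b)^n := by
    rw [div_rpow pi_pos.le (by positivity), ← Real.rpow_natCast b 2, ← Real.rpow_mul hb.le]
    have : ((2:ℕ):ℝ) * ((n:ℝ)/2) = n := by push_cast; ring
    rw [this, Real.rpow_natCast, one_div, inv_pow, div_eq_mul_inv]
  have e2 : (1/b)^n = (1/b)^(n-1) * (1/b) := by
    rw [← pow_succ]; congr 1; omega
  have e3 : ENNReal.ofReal (rexp 2 * b) * ENNReal.ofReal (rexp (-2) * (1/b)) = 1 := by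
    rw [← ENNReal.ofReal_mul (by positivity)]
    have : rexp 2 * b * (rexp (-2) * (1/b)) = 1 := by
      rw [Real.exp_neg]; field_simp
    rw [this, ENNReal.ofReal_one]
  have h8 := mul_le_mul_right h7 (ENNReal.ofReal (rexp 2 * b))
  rw [← mul_assoc, e3, one_mul, e1, e2, ← ENNReal.ofReal_mul (by positivity)] at h8
  refine h8.trans (ENNReal.ofReal_le_ofReal (le_of_eq ?_))
  field_simp

lemma aux_dir {n : ℕ} (hn : 2 ≤ n) (ξ : Euc n) : ∃ e : Euc n, ‖e‖ = 1 ∧ ξ = ‖ξ‖ • e := by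
  have hnt : Nontrivial (Euc n) := by
    have : Nonempty (Fin n) := ⟨⟨0, by omega⟩⟩
    infer_instance
  by_cases h : ξ = 0
  · obtain ⟨e, he⟩ := exists_norm_eq (Euc n) (zero_le_one : (0:ℝ) ≤ 1)
    exact ⟨e, he, by simp [h]⟩
  · have h' : ‖ξ‖ ≠ 0 := norm_ne_zero_iff.2 h
    exact ⟨‖ξ‖⁻¹ • ξ, by simp [norm_smul, h'], by simp [smul_smul, h']⟩

/-- the kernel integral -/
def Jk {n : ℕ} (δ lam : ℝ) (ξ : Euc n) : ℝ≥0∞ :=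
  ∫⁻ η : Euc n, ENNReal.ofReal (rexp (-(‖ξ - η‖^2 / lam)) * (δ⁻¹ * rexp (-((‖ξ‖ - ‖η‖)^2 / (4 * δ^2)))))

lemma aux_q (r : ℝ) {δ k : ℝ} (hδ : 0 < δ) (hk : 0 < k) :
    ∫⁻ ρ in Ioi (0:ℝ), ENNReal.ofReal (δ⁻¹ * rexp (-((r - ρ)^2 / (k * δ^2)))) ≤ ENNReal.ofReal (√(π * k)) := by
  refine (setLIntegral_le_lintegral _ _).trans ?_
  have h := aux_gauss1 r (b := 1 / (k * δ^2)) (by positivity)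
  simp only [ENNReal.ofReal_mul (inv_pos.2 hδ).le]
  rw [lintegral_const_mul _ (by fun_prop)]
  have h2 : ∀ ρ : ℝ, (r - ρ)^2 / (k * δ^2) = 1 / (k * δ^2) * (r - ρ)^2 := fun ρ => by ring
  simp only [h2]
  rw [h, ← ENNReal.ofReal_mul (inv_pos.2 hδ).le]
  apply ENNReal.ofReal_le_ofReal
  have : π / (1 / (k * δ^2)) = (π * k) * δ^2 := by field_simp
  rw [this, Real.sqrt_mul (by positivity), Real.sqrt_sq hδ.le]
  apply le_of_eq
  field_simp

lemma aux_J1 (n : ℕ) (hn : 2 ≤ n) : ∃ C > 0, ∀ (ξ : Euc n) (δ lam : ℝ), 0 < δ → 0 < lam →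
    Jk δ lam ξ ≤ ENNReal.ofReal (C * (√lam)^(n-1)) := by
  obtain ⟨C, hC, hS⟩ := aux_sph n hn
  refine ⟨C * (√8)^(n-1) * √(π * 4), by positivity, fun ξ δ lam hδ hlam => ?_⟩
  obtain ⟨e, he, hξ⟩ := aux_dir hn ξ
  rw [Jk, aux_polar hn _ (by fun_prop), lintegral_lintegral_swap (by fun_prop)]
  calc _ ≤ ∫⁻ ρ in Ioi (0:ℝ), ENNReal.ofReal (C * (√8)^(n-1) * (√lam)^(n-1)) *
        ENNReal.ofReal (δ⁻¹ * rexp (-((‖ξ‖ - ρ)^2 / (4 * δ^2)))) := by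
        refine setLIntegral_mono' measurableSet_Ioi fun ρ hρ => ?_
        have hρ' : 0 < ρ := hρ
        set b := ρ / √(8 * lam) with hbdef
        have hb : 0 < b := by positivity
        have hb2 : 2 * b^2 = ρ^2 / (4 * lam) := by
          rw [hbdef, div_pow, Real.sq_sqrt (by positivity)]; field_simp; norm_num
        calc _ ≤ ∫⁻ ω : Metric.sphere (0 : Euc n) 1, (ENNReal.ofReal (ρ^(n-1) * (δ⁻¹ * rexp (-((‖ξ‖ - ρ)^2 / (4 * δ^2))))) *
              ENNReal.ofReal (rexp (-(2 * b^2 * ‖(ω : Euc n) - e‖^2)))) ∂((volume : Measure (Euc n)).toSphere) := by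
              refine lintegral_mono fun ω => ?_
              have hω : ‖(ω : Euc n)‖ = 1 := by simp
              have hn1 : ‖ρ • (ω : Euc n)‖ = ρ := by rw [norm_smul, hω, mul_one, Real.norm_of_nonneg hρ'.le]
              rw [← ENNReal.ofReal_mul (by positivity), ← ENNReal.ofReal_mul (by positivity), hn1]
              apply ENNReal.ofReal_le_ofReal
              have h1 : ρ * ‖(ω : Euc n) - e‖ ≤ 2 * ‖ξ - ρ • (ω : Euc n)‖ := by
                have a1 : ρ * ‖(ω : Euc n) - e‖ = ‖(ρ • (ω : Euc n) - ξ) + (‖ξ‖ - ρ) • e‖ := by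
                  rw [← Real.norm_of_nonneg hρ'.le, ← norm_smul, Real.norm_of_nonneg hρ'.le]
                  congr 1
                  nth_rewrite 1 [hξ]
                  module
                have a2 : |‖ξ‖ - ρ| ≤ ‖ξ - ρ • (ω : Euc n)‖ := by
                  have := abs_norm_sub_norm_le ξ (ρ • (ω : Euc n))
                  rwa [hn1] at this
                rw [a1]
                refine (norm_add_le _ _).trans ?_
                rw [norm_smul, he, mul_one, norm_sub_rev, Real.norm_eq_abs]
                linarith
              have h2 : (ρ * ‖(ω : Euc n) - e‖)^2 ≤ 4 * ‖ξ - ρ • (ω : Euc n)‖^2 := by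
                have := pow_le_pow_left₀ (by positivity) h1 2
                linarith
              have h3 : 2 * b^2 * ‖(ω : Euc n) - e‖^2 ≤ ‖ξ - ρ • (ω : Euc n)‖^2 / lam := by
                rw [hb2, div_mul_eq_mul_div, ← mul_pow, div_le_div_iff₀ (by positivity) hlam]
                nlinarith
              calc _ ≤ ρ^(n-1) * (rexp (-(2 * b^2 * ‖(ω : Euc n) - e‖^2)) * (δ⁻¹ * rexp (-((‖ξ‖ - ρ)^2 / (4 * δ^2))))) := by
                    gcongr
                _ = _ := by ring
          _ ≤ ENNReal.ofReal (ρ^(n-1) * (δ⁻¹ * rexp (-((‖ξ‖ - ρ)^2 / (4 * δ^2))))) * ENNReal.ofReal (C * (1/b)^(n-1)) := by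
              rw [lintegral_const_mul _ (by fun_prop)]
              gcongr
              exact hS e he b hb
          _ = _ := by
              rw [← ENNReal.ofReal_mul (by positivity), ← ENNReal.ofReal_mul (by positivity)]
              congr 1
              rw [hbdef, one_div_div, div_pow, Real.sqrt_mul (by norm_num), mul_pow]
              field_simp
    _ ≤ ENNReal.ofReal (C * (√8)^(n-1) * (√lam)^(n-1)) * ENNReal.ofReal (√(π * 4)) := by
        rw [lintegral_const_mul _ (by fun_prop)]
        gcongr
        exact aux_q _ hδ (by norm_num)
    _ = _ := by
        rw [← ENNReal.ofReal_mul (by positivity)]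
        congr 1
        ring

lemma aux_J2 (n : ℕ) (hn : 2 ≤ n) : ∃ C > 0, ∀ (ξ : Euc n) (δ lam : ℝ), 0 < δ → 0 < lam →
    Jk δ lam ξ ≤ ENNReal.ofReal (C * (‖ξ‖ + δ)^(n-1)) := by
  set S := ((volume : Measure (Euc n)).toSphere univ).toReal with hSdef
  set A := rexp (2 * ((n-1 : ℕ):ℝ)^2) with hA
  refine ⟨(S + 1) * A * √(π * 8), by positivity, fun ξ δ lam hδ hlam => ?_⟩
  have hS' : (volume : Measure (Euc n)).toSphere univ ≤ ENNReal.ofReal (S + 1) := by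
    rw [← ENNReal.ofReal_toReal (measure_ne_top (volume : Measure (Euc n)).toSphere univ)]
    exact ENNReal.ofReal_le_ofReal (by linarith)
  rw [Jk, aux_polar hn _ (by fun_prop)]
  have key : ∀ ω : Metric.sphere (0 : Euc n) 1, ∫⁻ ρ in Ioi (0:ℝ), ENNReal.ofReal (ρ^(n-1)) *
      ENNReal.ofReal (rexp (-(‖ξ - ρ • (ω : Euc n)‖^2 / lam)) * (δ⁻¹ * rexp (-((‖ξ‖ - ‖ρ • (ω : Euc n)‖)^2 / (4 * δ^2)))))
      ≤ ENNReal.ofReal (A * (‖ξ‖ + δ)^(n-1) * √(π * 8)) := by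
    intro ω
    calc _ ≤ ∫⁻ ρ in Ioi (0:ℝ), ENNReal.ofReal (A * (‖ξ‖ + δ)^(n-1)) *
        ENNReal.ofReal (δ⁻¹ * rexp (-((‖ξ‖ - ρ)^2 / (8 * δ^2)))) := by
          refine setLIntegral_mono' measurableSet_Ioi fun ρ hρ => ?_
          have hρ' : 0 < ρ := hρ
          have hω : ‖(ω : Euc n)‖ = 1 := by simp
          have hn1 : ‖ρ • (ω : Euc n)‖ = ρ := by rw [norm_smul, hω, mul_one, Real.norm_of_nonneg hρ'.le]
          rw [← ENNReal.ofReal_mul (by positivity), ← ENNReal.ofReal_mul (by positivity), hn1]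
          apply ENNReal.ofReal_le_ofReal
          set v := |‖ξ‖ - ρ| / δ with hv
          have hv0 : 0 ≤ v := by positivity
          have hv2 : v^2 = (‖ξ‖ - ρ)^2 / δ^2 := by rw [hv, div_pow, sq_abs]
          have b1 : ρ ≤ (‖ξ‖ + δ) * rexp v := by
            have : |‖ξ‖ - ρ| = δ * v := by rw [hv]; field_simp
            have h1 : ρ ≤ ‖ξ‖ + δ * v := by linarith [neg_abs_le (‖ξ‖ - ρ)]
            have h2 := Real.add_one_le_exp v
            calc ρ ≤ (‖ξ‖ + δ) * (v + 1) := by nlinarith [norm_nonneg ξ, mul_nonneg (norm_nonneg ξ) hv0]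
              _ ≤ _ := by gcongr
          have b2 : ρ^(n-1) ≤ (‖ξ‖ + δ)^(n-1) * (A * rexp (v^2/8)) := by
            calc ρ^(n-1) ≤ ((‖ξ‖ + δ) * rexp v)^(n-1) := by gcongr
              _ = (‖ξ‖ + δ)^(n-1) * rexp ((n-1 : ℕ) * v) := by rw [mul_pow, ← Real.exp_nat_mul]
              _ ≤ _ := by
                rw [hA, ← Real.exp_add]
                gcongr
                nlinarith [sq_nonneg (v - 4 * ((n-1 : ℕ):ℝ))]
          have b3 : rexp (-(‖ξ - ρ • (ω : Euc n)‖^2 / lam)) ≤ 1 := Real.exp_le_one_iff.2 (by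
            have : 0 ≤ ‖ξ - ρ • (ω : Euc n)‖^2 / lam := by positivity
            linarith)
          have b4 : rexp (v^2/8) * rexp (-((‖ξ‖ - ρ)^2 / (4 * δ^2))) = rexp (-((‖ξ‖ - ρ)^2 / (8 * δ^2))) := by
            rw [← Real.exp_add, hv2]; congr 1; field_simp; ring
          calc _ ≤ (‖ξ‖ + δ)^(n-1) * (A * rexp (v^2/8)) * (1 * (δ⁻¹ * rexp (-((‖ξ‖ - ρ)^2 / (4 * δ^2))))) := by
                gcongr
            _ = _ := by rw [← b4]; ring
      _ ≤ ENNReal.ofReal (A * (‖ξ‖ + δ)^(n-1)) * ENNReal.ofReal (√(π * 8)) := by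
        rw [lintegral_const_mul _ (by fun_prop)]
        gcongr
        exact aux_q _ hδ (by norm_num)
      _ = _ := by
        rw [← ENNReal.ofReal_mul (by positivity)]
  refine (lintegral_mono key).trans ?_
  rw [lintegral_const]
  calc _ ≤ ENNReal.ofReal (A * (‖ξ‖ + δ)^(n-1) * √(π * 8)) * ENNReal.ofReal (S + 1) := by gcongr
    _ = _ := by
      rw [← ENNReal.ofReal_mul (by positivity)]
      congr 1; ring

lemma aux_lam_real (n : ℕ) (s : ℝ) (hs1 : 1/2 < s) (hs2 : s < (n : ℝ) / 2) {R : ℝ} (hR : 0 < R) :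
    (∫⁻ l in Ioc 0 (R^2), ENNReal.ofReal (l ^ (s - 3/2))) ≤ ENNReal.ofReal ((1/(s-1/2)) * R ^ (2*s-1)) ∧
    (∫⁻ l in Ioi (R^2), ENNReal.ofReal (l ^ (s - 1 - (n:ℝ)/2))) ≤
      ENNReal.ofReal ((1/((n:ℝ)/2 - s)) * R ^ (2*s-n)) := by
  have hR2 : 0 < R^2 := by positivity
  have e : ∀ y : ℝ, (R^2) ^ y = R ^ (2 * y) := fun y => by
    rw [← Real.rpow_natCast R 2, ← Real.rpow_mul hR.le]; norm_num
  constructor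
  · have hi : IntegrableOn (fun l : ℝ => l ^ (s - 3/2)) (Ioc 0 (R^2)) := by
      rw [← intervalIntegrable_iff_integrableOn_Ioc_of_le hR2.le]
      exact intervalIntegral.intervalIntegrable_rpow' (by linarith)
    rw [← ofReal_integral_eq_lintegral_ofReal hi
      ((ae_restrict_iff' measurableSet_Ioc).2 (ae_of_all _ fun l hl => Real.rpow_nonneg hl.1.le _)),
      ← intervalIntegral.integral_of_le hR2.le, integral_rpow (Or.inl (by linarith))]
    apply ENNReal.ofReal_le_ofReal
    rw [e, Real.zero_rpow (by linarith)]
    apply le_of_eq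
    rw [show 2 * (s - 3/2 + 1) = 2 * s - 1 by ring, show s - 3/2 + 1 = s - 1/2 by ring]
    ring
  · have hi := integrableOn_Ioi_rpow_of_lt (a := s - 1 - (n:ℝ)/2) (by linarith) hR2
    rw [← ofReal_integral_eq_lintegral_ofReal hi
      ((ae_restrict_iff' measurableSet_Ioi).2 (ae_of_all _ fun l hl => Real.rpow_nonneg (hR2.trans hl).le _)),
      integral_Ioi_rpow_of_lt (by linarith) hR2]
    apply ENNReal.ofReal_le_ofReal
    rw [e]
    apply le_of_eq
    rw [show 2 * (s - 1 - (n:ℝ)/2 + 1) = 2 * s - n by ring,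
      show s - 1 - (n:ℝ)/2 + 1 = -((n:ℝ)/2 - s) by ring, neg_div_neg_eq]
    ring

lemma aux_lam (n : ℕ) (hn : 2 ≤ n) (s : ℝ) (hs1 : 1/2 < s) (hs2 : s < (n : ℝ) / 2) :
    ∃ C > 0, ∀ (ξ : Euc n) (δ : ℝ), 0 < δ →
      ∫⁻ l in Ioi (0:ℝ), ENNReal.ofReal (l ^ (s-1) * (π / l) ^ ((n:ℝ)/2)) * Jk δ l ξ ≤
        ENNReal.ofReal (C * (‖ξ‖ + δ) ^ (2*s-1)) := by
  obtain ⟨C1, hC1, h1⟩ := aux_J1 n hn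
  obtain ⟨C2, hC2, h2⟩ := aux_J2 n hn
  have p1 : 0 < 1/(s-1/2) := by
    have : 0 < s - 1/2 := by linarith
    positivity
  have p2 : 0 < 1/((n:ℝ)/2 - s) := by
    have : 0 < (n:ℝ)/2 - s := by linarith
    positivity
  set P := π ^ ((n:ℝ)/2) with hP
  have hPpos : 0 < P := by positivity
  refine ⟨P * C1 * (1/(s-1/2)) + P * C2 * (1/((n:ℝ)/2 - s)), by positivity, fun ξ δ hδ => ?_⟩
  set R := ‖ξ‖ + δ with hRdef
  have hR : 0 < R := by positivity
  obtain ⟨i1, i2⟩ := aux_lam_real n s hs1 hs2 hR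
  have hn1 : ((n-1 : ℕ):ℝ) = n - 1 := by push_cast [Nat.cast_sub (by omega : 1 ≤ n)]; ring
  have hw : ∀ l : ℝ, 0 < l → l ^ (s-1) * (π / l) ^ ((n:ℝ)/2) = P * l ^ (s - 1 - (n:ℝ)/2) := by
    intro l hl
    rw [div_rpow pi_pos.le hl.le, Real.rpow_sub hl (s-1), hP]
    ring
  rw [← Ioc_union_Ioi_eq_Ioi (by positivity : (0:ℝ) ≤ R^2), lintegral_union measurableSet_Ioi
    (Set.disjoint_left.2 fun x hx hx' => absurd hx.2 (not_le.2 hx'))]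
  rw [add_mul, ENNReal.ofReal_add (by positivity) (by positivity)]
  refine add_le_add ?_ ?_
  · calc _ ≤ ∫⁻ l in Ioc 0 (R^2), ENNReal.ofReal (P * C1) * ENNReal.ofReal (l ^ (s - 3/2)) := by
          refine setLIntegral_mono' measurableSet_Ioc fun l hl => ?_
          have hl0 : 0 < l := hl.1
          rw [hw l hl0]
          refine (mul_le_mul_right (h1 ξ δ l hδ hl0) _).trans ?_
          rw [← ENNReal.ofReal_mul (by positivity), ← ENNReal.ofReal_mul (by positivity)]
          apply ENNReal.ofReal_le_ofReal
          have : (√l)^(n-1) = l ^ (((n:ℝ) - 1)/2) := by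
            rw [Real.sqrt_eq_rpow, ← Real.rpow_natCast, ← Real.rpow_mul hl0.le, hn1]; congr 1; ring
          rw [this, show s - 3/2 = (s - 1 - (n:ℝ)/2) + ((n:ℝ) - 1)/2 by ring, Real.rpow_add hl0]
          apply le_of_eq; ring
      _ ≤ _ := by
          rw [lintegral_const_mul _ (by fun_prop)]
          refine (mul_le_mul_right i1 _).trans ?_
          rw [← ENNReal.ofReal_mul (by positivity)]
          apply ENNReal.ofReal_le_ofReal
          apply le_of_eq; ring
  · calc _ ≤ ∫⁻ l in Ioi (R^2), ENNReal.ofReal (P * C2 * R^(n-1)) * ENNReal.ofReal (l ^ (s - 1 - (n:ℝ)/2)) := by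
          refine setLIntegral_mono' measurableSet_Ioi fun l hl => ?_
          have hl0 : 0 < l := lt_trans (by positivity) hl
          rw [hw l hl0]
          refine (mul_le_mul_right (h2 ξ δ l hδ hl0) _).trans ?_
          rw [← ENNReal.ofReal_mul (by positivity), ← ENNReal.ofReal_mul (by positivity)]
          apply ENNReal.ofReal_le_ofReal
          apply le_of_eq; ring
      _ ≤ _ := by
          rw [lintegral_const_mul _ (by fun_prop)]
          refine (mul_le_mul_right i2 _).trans ?_
          rw [← ENNReal.ofReal_mul (by positivity)]
          apply ENNReal.ofReal_le_ofReal
          have : R ^ (2*s-1) = R^(n-1) * R ^ (2 * s - n) := by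
            rw [← Real.rpow_natCast, ← Real.rpow_add hR, hn1]; congr 1; ring
          rw [this]
          apply le_of_eq; ring

lemma aux_abs {X Y : Type*} [MeasurableSpace X] [MeasurableSpace Y] (μ : Measure X) [IsFiniteMeasure μ]
    (ν : Measure Y) [SFinite ν] (θ : X × Y → ℂ) (hθ : Measurable θ) (hθ1 : ∀ p, ‖θ p‖ = 1)
    (g : Y → ℂ) (hg : Measurable g) (hgi : Integrable g ν)
    (k : Y × Y → ℝ≥0∞) (hk : Measurable k) (hks : ∀ a b, k (a, b) = k (b, a))
    (hK : ∀ a b, ‖∫ x, θ (x, a) * starRingEnd ℂ (θ (x, b)) ∂μ‖ₑ ≤ k (a, b)) :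
    ∫⁻ x, ENNReal.ofReal (‖∫ y, θ (x, y) * g y ∂ν‖^2) ∂μ ≤
      2 * ∫⁻ a, ENNReal.ofReal (‖g a‖^2) * ∫⁻ b, k (a, b) ∂ν ∂ν := by
  set U : X → ℂ := fun x => ∫ y, θ (x, y) * g y ∂ν with hU
  have hUm : StronglyMeasurable U := by
    apply StronglyMeasurable.integral_prod_right (f := fun x y => θ (x, y) * g y)
    exact (Measurable.stronglyMeasurable (by fun_prop))
  have hUb : ∀ x, ‖U x‖ ≤ ∫ y, ‖g y‖ ∂ν := by
    intro x
    refine (norm_integral_le_integral_norm _).trans (le_of_eq ?_)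
    simp [hθ1]
  have hUi : Integrable (fun x => ‖U x‖^2) μ := by
    refine Integrable.of_bound (by fun_prop) ((∫ y, ‖g y‖ ∂ν)^2) (ae_of_all _ fun x => ?_)
    rw [Real.norm_of_nonneg (by positivity)]
    have := hUb x
    gcongr
  set F : X → Y × Y → ℂ := fun x p => (θ (x, p.1) * g p.1) * starRingEnd ℂ (θ (x, p.2) * g p.2) with hF
  have hFi : Integrable (Function.uncurry F) (μ.prod (ν.prod ν)) := by
    have h0 : Integrable (fun q : X × (Y × Y) => (1:ℝ) * (‖g q.2.1‖ * ‖g q.2.2‖)) (μ.prod (ν.prod ν)) :=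
      (integrable_const (1:ℝ)).mul_prod (hgi.norm.mul_prod hgi.norm)
    refine h0.mono' ?_ (ae_of_all _ fun q => ?_)
    · apply Measurable.aestronglyMeasurable
      simp only [hF, Function.uncurry_def]
      have : Measurable (starRingEnd ℂ) := Complex.continuous_conj.measurable
      fun_prop
    · simp [hF, Function.uncurry_def, hθ1]
  have hsq : ∀ x, ((‖U x‖^2 : ℝ) : ℂ) = ∫ p, F x p ∂(ν.prod ν) := by
    intro x
    rw [hF]
    simp only
    rw [integral_prod_mul (fun y => θ (x, y) * g y) (fun y => starRingEnd ℂ (θ (x, y) * g y)), integral_conj]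
    rw [Complex.mul_conj, Complex.normSq_eq_norm_sq]
  have h1 : ((∫ x, ‖U x‖^2 ∂μ : ℝ) : ℂ) = ∫ p, (g p.1 * starRingEnd ℂ (g p.2)) *
      ∫ x, θ (x, p.1) * starRingEnd ℂ (θ (x, p.2)) ∂μ ∂(ν.prod ν) := by
    rw [← integral_complex_ofReal]
    simp only [hsq]
    rw [integral_integral_swap hFi]
    refine integral_congr_ae (ae_of_all _ fun p => ?_)
    simp only
    rw [← integral_const_mul]
    refine integral_congr_ae (ae_of_all _ fun x => ?_)
    simp only [hF, map_mul]
    ring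
  rw [← ofReal_integral_eq_lintegral_ofReal hUi (ae_of_all _ fun _ => by positivity)]
  have h2 : ENNReal.ofReal (∫ x, ‖U x‖^2 ∂μ) = ‖((∫ x, ‖U x‖^2 ∂μ : ℝ) : ℂ)‖ₑ := by
    rw [← ofReal_norm, Complex.norm_real, Real.norm_of_nonneg (integral_nonneg fun _ => by positivity)]
  rw [h2, h1]
  refine (enorm_integral_le_lintegral_enorm _).trans ?_
  have hgm : Measurable (fun a => ENNReal.ofReal (‖g a‖^2)) := by fun_prop
  calc _ ≤ ∫⁻ p, (ENNReal.ofReal (‖g p.1‖^2) * k (p.1, p.2) + ENNReal.ofReal (‖g p.2‖^2) * k (p.1, p.2)) ∂(ν.prod ν) := by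
        refine lintegral_mono fun p => ?_
        rw [enorm_mul, ← add_mul]
        gcongr
        · rw [← ENNReal.ofReal_add (by positivity) (by positivity), ← ofReal_norm]
          apply ENNReal.ofReal_le_ofReal
          rw [norm_mul, RCLike.norm_conj]
          nlinarith [sq_nonneg (‖g p.1‖ - ‖g p.2‖), sq_nonneg (‖g p.1‖), sq_nonneg (‖g p.2‖)]
        · exact hK _ _
    _ = _ := by
        rw [lintegral_add_left (by fun_prop), lintegral_prod _ (by fun_prop), lintegral_prod_symm _ (by fun_prop), two_mul]
        congr 1
        · refine lintegral_congr fun a => ?_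
          simp only
          rw [lintegral_const_mul _ (by fun_prop)]
        · refine lintegral_congr fun a => ?_
          simp only
          rw [lintegral_const_mul _ (by fun_prop)]
          simp only [hks _ a]

/-- phase -/
def phs {n : ℕ} (p : (ℝ × Euc n) × Euc n) : ℂ :=
  Complex.exp (2 * π * Complex.I * (⟪p.1.2, p.2⟫ : ℝ)) * Complex.exp (Complex.I * p.1.1 * ‖p.2‖)

lemma phs_meas {n : ℕ} : Measurable (phs (n := n)) := by
  apply Continuous.measurable
  unfold phs
  fun_prop

lemma phs_norm {n : ℕ} (p : (ℝ × Euc n) × Euc n) : ‖phs p‖ = 1 := by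
  rw [phs, norm_mul, Complex.norm_exp, Complex.norm_exp]
  simp

/-- gaussian measure in time -/
def gm1 (δ : ℝ) : Measure ℝ := volume.withDensity fun t => ENNReal.ofReal (rexp (-(δ^2) * ‖t‖^2))
/-- gaussian measure in space -/
def gm2 (n : ℕ) (l : ℝ) : Measure (Euc n) := volume.withDensity fun t => ENNReal.ofReal (rexp (-l * ‖t‖^2))

lemma gauss_int {V : Type*} [NormedAddCommGroup V] [InnerProductSpace ℝ V] [FiniteDimensional ℝ V]
    [MeasurableSpace V] [BorelSpace V] {l : ℝ} (hl : 0 < l) :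
    Integrable (fun v : V => rexp (-l * ‖v‖^2)) :=
  .of_integral_ne_zero (by rw [GaussianFourier.integral_rexp_neg_mul_sq_norm hl]; positivity)

lemma gauss_ft {V : Type*} [NormedAddCommGroup V] [InnerProductSpace ℝ V] [FiniteDimensional ℝ V]
    [MeasurableSpace V] [BorelSpace V] {l : ℝ} (hl : 0 < l) (c : ℝ) (w : V) :
    ‖∫ v, Complex.exp (c * Complex.I * (⟪w, v⟫ : ℝ)) ∂((volume : Measure V).withDensity fun t => ENNReal.ofReal (rexp (-l * ‖t‖^2)))‖
      = (π / l) ^ ((Module.finrank ℝ V : ℝ)/2) * rexp (-(c^2 * ‖w‖^2 / (4 * l))) := by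
  rw [integral_withDensity_eq_integral_toReal_smul (by fun_prop) (by simp)]
  have h := GaussianFourier.integral_cexp_neg_mul_sq_norm_add (V := V) (b := (l:ℂ)) (by simpa using hl) (c * Complex.I) w
  have h2 : ∀ v : V, (ENNReal.ofReal (rexp (-l * ‖v‖^2))).toReal • Complex.exp (c * Complex.I * (⟪w, v⟫ : ℝ)) =
      Complex.exp (-(l:ℂ) * ‖v‖^2 + c * Complex.I * (⟪w, v⟫ : ℝ)) := by
    intro v
    rw [ENNReal.toReal_ofReal (exp_pos _).le, Complex.real_smul, Complex.exp_add]
    push_cast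
    rfl
  simp only [h2]
  rw [h, norm_mul]
  congr 1
  · have : ((π:ℂ) / l) ^ ((Module.finrank ℝ V : ℂ)/2) = (((π / l) ^ ((Module.finrank ℝ V : ℝ)/2) : ℝ) : ℂ) := by
      rw [Complex.ofReal_cpow (by positivity)]; push_cast; rfl
    rw [this, Complex.norm_real, Real.norm_of_nonneg (by positivity)]
  · rw [Complex.norm_exp]
    congr 1
    have : ((c:ℂ) * Complex.I)^2 * (‖w‖:ℂ)^2 / (4 * (l:ℂ)) = ((-(c^2 * ‖w‖^2 / (4 * l)) : ℝ) : ℂ) := by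
      rw [mul_pow, Complex.I_sq]; push_cast; ring
    rw [this, Complex.ofReal_re]

lemma gm1_fin {δ : ℝ} (h : 0 < δ) : IsFiniteMeasure (gm1 δ) :=
  isFiniteMeasure_withDensity_ofReal (gauss_int (V := ℝ) (by positivity : 0 < δ^2)).2

lemma gm2_fin (n : ℕ) {l : ℝ} (h : 0 < l) : IsFiniteMeasure (gm2 n l) :=
  isFiniteMeasure_withDensity_ofReal (gauss_int (V := Euc n) h).2

lemma ker_bound {n : ℕ} {δ l : ℝ} (hδ : 0 < δ) (hl : 0 < l) (a b : Euc n) :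
    ‖∫ p, phs (p, a) * starRingEnd ℂ (phs (p, b)) ∂((gm1 δ).prod (gm2 n l))‖ ≤
      (√π * (π / l) ^ ((n:ℝ)/2)) * (rexp (-(‖a - b‖^2 / l)) * (δ⁻¹ * rexp (-((‖a‖ - ‖b‖)^2 / (4 * δ^2))))) := by
  have := gm1_fin hδ
  have := gm2_fin n hl
  have h1 : ∀ p : ℝ × Euc n, phs (p, a) * starRingEnd ℂ (phs (p, b)) =
      Complex.exp ((1:ℝ) * Complex.I * (⟪‖a‖ - ‖b‖, p.1⟫ : ℝ)) * Complex.exp ((2 * π : ℝ) * Complex.I * (⟪a - b, p.2⟫ : ℝ)) := by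
    intro p
    simp only [phs, ← Complex.exp_conj, ← Complex.exp_add]
    congr 1
    rw [inner_sub_left a b, real_inner_comm a p.2, real_inner_comm b p.2]
    have h2 : starRingEnd ℂ (2:ℂ) = 2 := Complex.conj_ofReal 2
    simp [h2]
    ring
  simp only [h1]
  rw [integral_prod_mul (fun t : ℝ => Complex.exp ((1:ℝ) * Complex.I * (⟪‖a‖ - ‖b‖, t⟫ : ℝ)))
    (fun x : Euc n => Complex.exp ((2 * π : ℝ) * Complex.I * (⟪a - b, x⟫ : ℝ))), norm_mul, gm1, gm2,
    gauss_ft (by positivity), gauss_ft hl]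
  have e1 : (π / δ^2) ^ ((Module.finrank ℝ ℝ : ℝ)/2) = √π * δ⁻¹ := by
    rw [Module.finrank_self, Nat.cast_one, ← Real.sqrt_eq_rpow, Real.sqrt_div pi_pos.le, Real.sqrt_sq hδ.le]
    rfl
  have e2 : rexp (-((2*π)^2 * ‖a - b‖^2 / (4 * l))) ≤ rexp (-(‖a - b‖^2 / l)) := by
    apply Real.exp_le_exp.2
    have : (2*π)^2 * ‖a - b‖^2 / (4 * l) = π^2 * (‖a - b‖^2 / l) := by field_simp; ring
    rw [this]
    have h3 : 0 ≤ ‖a - b‖^2 / l := by positivity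
    have h4 : 1 ≤ π^2 := by nlinarith [pi_gt_three]
    nlinarith
  have e3 : rexp (-((1:ℝ)^2 * ‖‖a‖ - ‖b‖‖^2 / (4 * δ^2))) = rexp (-((‖a‖ - ‖b‖)^2 / (4 * δ^2))) := by
    rw [Real.norm_eq_abs, sq_abs]; simp
  rw [e1, e3, finrank_euclideanSpace_fin]
  calc _ ≤ √π * δ⁻¹ * rexp (-((‖a‖ - ‖b‖)^2 / (4 * δ^2))) * ((π / l) ^ ((n:ℝ)/2) * rexp (-(‖a - b‖^2 / l))) := by gcongr
    _ = _ := by ring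

lemma fourier_part {n : ℕ} {δ l : ℝ} (hδ : 0 < δ) (hl : 0 < l) (g : Euc n → ℂ) (hg : Measurable g) (hgi : Integrable g) :
    ∫⁻ p : ℝ × Euc n, ENNReal.ofReal (rexp (-(δ^2) * ‖p.1‖^2)) * ENNReal.ofReal (rexp (-l * ‖p.2‖^2)) *
      ENNReal.ofReal (‖∫ y, phs (p, y) * g y‖^2) ≤
    ENNReal.ofReal (2 * √π * (π / l) ^ ((n:ℝ)/2)) * ∫⁻ a, ENNReal.ofReal (‖g a‖^2) * Jk δ l a := by
  have := gm1_fin hδ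
  have := gm2_fin n hl
  have h := aux_abs ((gm1 δ).prod (gm2 n l)) volume phs phs_meas phs_norm g hg hgi
    (fun q => ENNReal.ofReal ((√π * (π / l) ^ ((n:ℝ)/2))) * ENNReal.ofReal (rexp (-(‖q.1 - q.2‖^2 / l)) * (δ⁻¹ * rexp (-((‖q.1‖ - ‖q.2‖)^2 / (4 * δ^2))))))
    (by fun_prop) (fun a b => by
      simp only
      rw [norm_sub_rev, show (‖a‖ - ‖b‖)^2 = (‖b‖ - ‖a‖)^2 by ring])
    (fun a b => by
      rw [← ofReal_norm, ← ENNReal.ofReal_mul (by positivity)]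
      exact ENNReal.ofReal_le_ofReal (ker_bound hδ hl a b))
  have hUm : Measurable (fun p : ℝ × Euc n => ENNReal.ofReal (‖∫ y, phs (p, y) * g y‖^2)) := by
    have : StronglyMeasurable (fun p : ℝ × Euc n => ∫ y, phs (p, y) * g y) := by
      apply StronglyMeasurable.integral_prod_right (f := fun x y => phs (x, y) * g y)
      have := phs_meas (n := n)
      exact (Measurable.stronglyMeasurable (by fun_prop))
    have := this.measurable
    fun_prop
  rw [gm1, gm2, prod_withDensity (by fun_prop) (by fun_prop),
    lintegral_withDensity_eq_lintegral_mul _ (by fun_prop) hUm] at h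
  refine h.trans (le_of_eq ?_)
  have hJ : ∀ a : Euc n, ∫⁻ b : Euc n, ENNReal.ofReal ((√π * (π / l) ^ ((n:ℝ)/2))) * ENNReal.ofReal (rexp (-(‖a - b‖^2 / l)) * (δ⁻¹ * rexp (-((‖a‖ - ‖b‖)^2 / (4 * δ^2)))))
      = ENNReal.ofReal ((√π * (π / l) ^ ((n:ℝ)/2))) * Jk δ l a := by
    intro a
    rw [lintegral_const_mul _ (by fun_prop), Jk]
  simp only [hJ]
  have hJm : Measurable (fun a : Euc n => Jk δ l a) := by
    unfold Jk
    apply Measurable.lintegral_prod_right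
    fun_prop
  simp only [mul_left_comm _ (ENNReal.ofReal ((√π * (π / l) ^ ((n:ℝ)/2)))) _]
  rw [lintegral_const_mul _ (by fun_prop), ← mul_assoc]
  congr 1
  rw [mul_assoc 2, ENNReal.ofReal_mul zero_le_two]
  simp

lemma aux_gamma {n : ℕ} {s : ℝ} (hs : 0 < s) (x : Euc n) :
    ENNReal.ofReal (‖x‖ ^ (-(2*s))) ≤ ENNReal.ofReal (1 / Real.Gamma s) *
      ∫⁻ l in Ioi (0:ℝ), ENNReal.ofReal (l ^ (s-1)) * ENNReal.ofReal (rexp (-l * ‖x‖^2)) := by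
  by_cases hx : x = 0
  · rw [hx, norm_zero, Real.zero_rpow (by linarith)]; simp
  have hx' : 0 < ‖x‖ := norm_pos_iff.2 hx
  have hG := Real.Gamma_pos_of_pos hs
  have h := Real.integral_rpow_mul_exp_neg_mul_Ioi hs (by positivity : 0 < ‖x‖^2)
  have hi : IntegrableOn (fun t : ℝ => t ^ (s-1) * rexp (-(‖x‖^2 * t))) (Ioi 0) :=
    .of_integral_ne_zero (by rw [h]; positivity)
  have h2 := ofReal_integral_eq_lintegral_ofReal hi
    ((ae_restrict_iff' measurableSet_Ioi).2 (ae_of_all _ fun l hl => mul_nonneg (Real.rpow_nonneg (le_of_lt hl) _) (exp_pos _).le))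
  have h3 : ∫⁻ l in Ioi (0:ℝ), ENNReal.ofReal (l ^ (s-1)) * ENNReal.ofReal (rexp (-l * ‖x‖^2)) =
      ENNReal.ofReal ((1 / ‖x‖^2) ^ s * Real.Gamma s) := by
    rw [← h, h2]
    refine setLIntegral_congr_fun measurableSet_Ioi fun l hl => ?_
    rw [← ENNReal.ofReal_mul (Real.rpow_nonneg (le_of_lt hl) _)]
    congr 3
    ring
  rw [h3, ← ENNReal.ofReal_mul (by positivity)]
  apply ENNReal.ofReal_le_ofReal
  apply le_of_eq
  rw [one_div (‖x‖^2), Real.inv_rpow (by positivity), ← Real.rpow_natCast ‖x‖ 2, ← Real.rpow_mul hx'.le, Real.rpow_neg hx'.le]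
  push_cast
  field_simp

lemma U_meas {n : ℕ} (g : Euc n → ℂ) (hg : Measurable g) :
    Measurable (fun p : ℝ × Euc n => ENNReal.ofReal (‖∫ y, phs (p, y) * g y‖^2)) := by
  have : StronglyMeasurable (fun p : ℝ × Euc n => ∫ y, phs (p, y) * g y) := by
    apply StronglyMeasurable.integral_prod_right (f := fun x y => phs (x, y) * g y)
    have := phs_meas (n := n)
    exact (Measurable.stronglyMeasurable (by fun_prop))
  have := this.measurable
  fun_prop

lemma Jk_meas {n : ℕ} (δ : ℝ) : Measurable (fun q : ℝ × Euc n => Jk δ q.1 q.2) := by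
  unfold Jk
  apply Measurable.lintegral_prod_right
  fun_prop

lemma swapJ {n : ℕ} (J : ℝ → Euc n → ℝ≥0∞) (hJ : Measurable (fun q : ℝ × Euc n => J q.1 q.2))
    (G : Euc n → ℝ≥0∞) (hG : Measurable G) (w : ℝ → ℝ≥0∞) (hw : Measurable w) (c : ℝ≥0∞) :
    ∫⁻ l in Ioi (0:ℝ), c * (w l * ∫⁻ a, G a * J l a) = c * ∫⁻ a, G a * ∫⁻ l in Ioi (0:ℝ), w l * J l a := by
  have hJ1 : ∀ l, Measurable (fun a => J l a) := fun l => hJ.comp (by fun_prop : Measurable fun a : Euc n => (l, a))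
  have hJ2 : ∀ a, Measurable (fun l => J l a) := fun a => hJ.comp (by fun_prop : Measurable fun l : ℝ => (l, a))
  have hm : Measurable (fun l => ∫⁻ a, G a * J l a) := by
    apply Measurable.lintegral_prod_right
    simp only [Function.uncurry_def]
    fun_prop
  rw [lintegral_const_mul _ (by fun_prop)]
  congr 1
  calc _ = ∫⁻ l in Ioi (0:ℝ), ∫⁻ a, G a * (w l * J l a) := by
        refine lintegral_congr fun l => ?_
        have := hJ1 l
        rw [← lintegral_const_mul _ (by fun_prop)]
        exact lintegral_congr fun a => mul_left_comm _ _ _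
    _ = ∫⁻ a, ∫⁻ l in Ioi (0:ℝ), G a * (w l * J l a) := by
        rw [lintegral_lintegral_swap]
        apply Measurable.aemeasurable
        simp only [Function.uncurry_def]
        fun_prop
    _ = _ := by
        refine lintegral_congr fun a => ?_
        have := hJ2 a
        rw [lintegral_const_mul _ (by fun_prop)]

lemma main_delta (n : ℕ) (hn : 2 ≤ n) (s : ℝ) (hs1 : 1/2 < s) (hs2 : s < (n : ℝ) / 2) :
    ∃ C > 0, ∀ (g : Euc n → ℂ), Measurable g → Integrable g → ∀ δ : ℝ, 0 < δ →
      ∫⁻ p : ℝ × Euc n, ENNReal.ofReal (rexp (-(δ^2) * ‖p.1‖^2)) *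
        (ENNReal.ofReal (‖p.2‖ ^ (-(2*s))) * ENNReal.ofReal (‖∫ y, phs (p, y) * g y‖^2)) ≤
      ENNReal.ofReal C * ∫⁻ a, ENNReal.ofReal (‖g a‖^2) * ENNReal.ofReal ((‖a‖ + δ) ^ (2*s-1)) := by
  obtain ⟨C, hC, hlam⟩ := aux_lam n hn s hs1 hs2
  have hs : 0 < s := by linarith
  have hG := Real.Gamma_pos_of_pos hs
  refine ⟨1 / Real.Gamma s * (2 * √π) * C, by positivity, fun g hg hgi δ hδ => ?_⟩
  have hU := U_meas g hg
  have hJ := Jk_meas (n := n) δ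
  set W : ℝ × Euc n → ℝ≥0∞ := fun p => ENNReal.ofReal (‖∫ y, phs (p, y) * g y‖^2) with hW
  have hWp : ∀ p, ENNReal.ofReal (‖∫ y, phs (p, y) * g y‖^2) = W p := fun _ => rfl
  simp only [hWp]
  calc _ ≤ ∫⁻ p : ℝ × Euc n, ENNReal.ofReal (1 / Real.Gamma s) * ∫⁻ l in Ioi (0:ℝ), ENNReal.ofReal (l ^ (s-1)) *
        (ENNReal.ofReal (rexp (-(δ^2) * ‖p.1‖^2)) * ENNReal.ofReal (rexp (-l * ‖p.2‖^2)) * W p) := by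
        refine lintegral_mono fun p => ?_
        calc _ ≤ ENNReal.ofReal (rexp (-(δ^2) * ‖p.1‖^2)) * ((ENNReal.ofReal (1 / Real.Gamma s) *
              ∫⁻ l in Ioi (0:ℝ), ENNReal.ofReal (l ^ (s-1)) * ENNReal.ofReal (rexp (-l * ‖p.2‖^2))) * W p) := by
              gcongr
              exact aux_gamma hs p.2
          _ = ENNReal.ofReal (1 / Real.Gamma s) * ((ENNReal.ofReal (rexp (-(δ^2) * ‖p.1‖^2)) * W p) * ∫⁻ l in Ioi (0:ℝ), ENNReal.ofReal (l ^ (s-1)) * ENNReal.ofReal (rexp (-l * ‖p.2‖^2))) := by ring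
          _ ≤ _ := by
              rw [← lintegral_const_mul _ (by fun_prop)]
              refine mul_le_mul_right (lintegral_mono fun l => le_of_eq ?_) _
              ring
    _ = ENNReal.ofReal (1 / Real.Gamma s) * ∫⁻ l in Ioi (0:ℝ), ENNReal.ofReal (l ^ (s-1)) * ∫⁻ p : ℝ × Euc n,
        (ENNReal.ofReal (rexp (-(δ^2) * ‖p.1‖^2)) * ENNReal.ofReal (rexp (-l * ‖p.2‖^2)) * W p) := by
        rw [lintegral_const_mul, lintegral_lintegral_swap]
        · congr 1
          refine lintegral_congr fun l => ?_
          rw [lintegral_const_mul _ (by fun_prop)]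
        · fun_prop
        · apply Measurable.lintegral_prod_right
          fun_prop
    _ ≤ ENNReal.ofReal (1 / Real.Gamma s) * ∫⁻ l in Ioi (0:ℝ), ENNReal.ofReal (l ^ (s-1)) *
        (ENNReal.ofReal (2 * √π * (π / l) ^ ((n:ℝ)/2)) * ∫⁻ a, ENNReal.ofReal (‖g a‖^2) * Jk δ l a) := by
        gcongr 1
        refine setLIntegral_mono' measurableSet_Ioi fun l hl => ?_
        gcongr
        exact fourier_part hδ hl g hg hgi
    _ = ENNReal.ofReal (1 / Real.Gamma s * (2 * √π)) * ∫⁻ a, ENNReal.ofReal (‖g a‖^2) *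
          ∫⁻ l in Ioi (0:ℝ), ENNReal.ofReal (l ^ (s-1) * (π / l) ^ ((n:ℝ)/2)) * Jk δ l a := by
        rw [ENNReal.ofReal_mul (by positivity), mul_assoc,
          ← swapJ (Jk δ) hJ (fun a => ENNReal.ofReal (‖g a‖^2)) (by fun_prop)
            (fun l => ENNReal.ofReal (l ^ (s-1) * (π / l) ^ ((n:ℝ)/2))) (by fun_prop)]
        congr 1
        refine setLIntegral_congr_fun measurableSet_Ioi fun l hl => ?_
        have hl' : 0 < l := hl
        rw [ENNReal.ofReal_mul (by positivity), ENNReal.ofReal_mul (p := l ^ (s-1)) (by positivity)]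
        ring
    _ ≤ ENNReal.ofReal (1 / Real.Gamma s * (2 * √π)) * ∫⁻ a, ENNReal.ofReal (‖g a‖^2) *
          ENNReal.ofReal (C * (‖a‖ + δ) ^ (2*s-1)) := by
        gcongr with a
        exact hlam a δ hδ
    _ = _ := by
        simp only [ENNReal.ofReal_mul hC.le, mul_left_comm _ (ENNReal.ofReal C) _]
        rw [lintegral_const_mul _ (by fun_prop), ← mul_assoc, ← ENNReal.ofReal_mul (by positivity)]

open Filter Topology in
lemma main_lint (n : ℕ) (hn : 2 ≤ n) (s : ℝ) (hs1 : 1/2 < s) (hs2 : s < (n : ℝ) / 2) :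
    ∃ C > 0, ∀ (g : Euc n → ℂ), Measurable g → Integrable g → ∫⁻ a, ENNReal.ofReal (‖g a‖^2) ≠ ⊤ →
      ∫⁻ p : ℝ × Euc n,
        (ENNReal.ofReal (‖p.2‖ ^ (-(2*s))) * ENNReal.ofReal (‖∫ y, phs (p, y) * g y‖^2)) ≤
      ENNReal.ofReal C * ∫⁻ a, ENNReal.ofReal (‖g a‖^2) * ENNReal.ofReal (‖a‖ ^ (2*s-1)) := by
  obtain ⟨C, hC, hmain⟩ := main_delta n hn s hs1 hs2
  have hp : 0 < 2 * s - 1 := by linarith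
  refine ⟨C * 2 ^ (2*s-1), by positivity, fun g hg hgi hfin => ?_⟩
  have hU := U_meas g hg
  set W : ℝ × Euc n → ℝ≥0∞ := fun p => ENNReal.ofReal (‖∫ y, phs (p, y) * g y‖^2) with hW
  have hWp : ∀ p, ENNReal.ofReal (‖∫ y, phs (p, y) * g y‖^2) = W p := fun _ => rfl
  simp only [hWp] at hmain ⊢
  set d : ℕ → ℝ := fun k => 1 / ((k:ℝ) + 1) with hd
  have hdpos : ∀ k, 0 < d k := fun k => by simp only [hd]; positivity
  have hdlim : Tendsto d atTop (𝓝 0) := tendsto_one_div_add_atTop_nhds_zero_nat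
  set A := ∫⁻ a, ENNReal.ofReal (‖g a‖^2) * ENNReal.ofReal (‖a‖ ^ (2*s-1)) with hA
  set B := ∫⁻ a, ENNReal.ofReal (‖g a‖^2) with hB
  have hbd : ∀ k, ∫⁻ p : ℝ × Euc n, ENNReal.ofReal (rexp (-((d k)^2) * ‖p.1‖^2)) *
        (ENNReal.ofReal (‖p.2‖ ^ (-(2*s))) * W p) ≤ ENNReal.ofReal (C * 2 ^ (2*s-1)) * (A + B * ENNReal.ofReal ((d k) ^ (2*s-1))) := by
    intro k
    refine (hmain g hg hgi (d k) (hdpos k)).trans ?_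
    rw [ENNReal.ofReal_mul hC.le, mul_assoc]
    refine mul_le_mul_right ?_ _
    rw [hA, hB, ← lintegral_mul_const _ (by fun_prop), ← lintegral_add_left (by fun_prop),
      ← lintegral_const_mul _ (by fun_prop)]
    refine lintegral_mono fun a => ?_
    rw [← mul_add, mul_left_comm]
    refine mul_le_mul_right ?_ _
    have hdk := hdpos k
    rw [← ENNReal.ofReal_add (by positivity) (by positivity), ← ENNReal.ofReal_mul (by positivity)]
    apply ENNReal.ofReal_le_ofReal
    rcases le_total ‖a‖ (d k) with h | h
    · calc (‖a‖ + d k) ^ (2*s-1) ≤ (2 * d k) ^ (2*s-1) := by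
            apply Real.rpow_le_rpow (by positivity) (by linarith) hp.le
        _ = 2 ^ (2*s-1) * (d k) ^ (2*s-1) := Real.mul_rpow (by norm_num) hdk.le
        _ ≤ _ := by
          gcongr
          have : 0 ≤ ‖a‖ ^ (2*s-1) := by positivity
          linarith
    · calc (‖a‖ + d k) ^ (2*s-1) ≤ (2 * ‖a‖) ^ (2*s-1) := by
            apply Real.rpow_le_rpow (by positivity) (by linarith) hp.le
        _ = 2 ^ (2*s-1) * ‖a‖ ^ (2*s-1) := Real.mul_rpow (by norm_num) (norm_nonneg _)
        _ ≤ _ := by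
          gcongr
          have : 0 ≤ (d k) ^ (2*s-1) := by positivity
          linarith
  have hlimR : Tendsto (fun k => ENNReal.ofReal (C * 2 ^ (2*s-1)) * (A + B * ENNReal.ofReal ((d k) ^ (2*s-1)))) atTop
      (𝓝 (ENNReal.ofReal (C * 2 ^ (2*s-1)) * (A + B * 0))) := by
    have h1 : Tendsto (fun k => ENNReal.ofReal ((d k) ^ (2*s-1))) atTop (𝓝 0) := by
      have : Tendsto (fun k => (d k) ^ (2*s-1)) atTop (𝓝 (0 ^ (2*s-1))) := hdlim.rpow_const (Or.inr hp.le)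
      rw [Real.zero_rpow hp.ne'] at this
      simpa using ENNReal.tendsto_ofReal this
    exact ENNReal.Tendsto.const_mul (tendsto_const_nhds.add (ENNReal.Tendsto.const_mul h1 (Or.inr hfin)))
      (Or.inr ENNReal.ofReal_ne_top)
  have hlimL : ∀ p : ℝ × Euc n, Tendsto (fun k => ENNReal.ofReal (rexp (-((d k)^2) * ‖p.1‖^2)) *
        (ENNReal.ofReal (‖p.2‖ ^ (-(2*s))) * W p)) atTop (𝓝 (ENNReal.ofReal (‖p.2‖ ^ (-(2*s))) * W p)) := by
    intro p
    have h1 : Tendsto (fun k => ENNReal.ofReal (rexp (-((d k)^2) * ‖p.1‖^2))) atTop (𝓝 1) := by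
      have : Tendsto (fun k => rexp (-((d k)^2) * ‖p.1‖^2)) atTop (𝓝 (rexp (-(0^2) * ‖p.1‖^2))) :=
        (Real.continuous_exp.tendsto _).comp (((hdlim.pow 2).neg).mul_const _)
      simpa using ENNReal.tendsto_ofReal this
    simpa using ENNReal.Tendsto.mul_const h1 (Or.inl one_ne_zero)
  calc _ = ∫⁻ p : ℝ × Euc n, liminf (fun k => ENNReal.ofReal (rexp (-((d k)^2) * ‖p.1‖^2)) *
        (ENNReal.ofReal (‖p.2‖ ^ (-(2*s))) * W p)) atTop := lintegral_congr fun p => (hlimL p).liminf_eq.symm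
    _ ≤ liminf (fun k => ∫⁻ p : ℝ × Euc n, ENNReal.ofReal (rexp (-((d k)^2) * ‖p.1‖^2)) *
        (ENNReal.ofReal (‖p.2‖ ^ (-(2*s))) * W p)) atTop := lintegral_liminf_le (fun k => by fun_prop)
    _ ≤ liminf (fun k => ENNReal.ofReal (C * 2 ^ (2*s-1)) * (A + B * ENNReal.ofReal ((d k) ^ (2*s-1)))) atTop :=
        liminf_le_liminf (Eventually.of_forall hbd)
    _ = _ := by rw [hlimR.liminf_eq]; simp

lemma sch_int {n : ℕ} (g : SchwartzMap (Euc n) ℂ) {p : ℝ} (hp : 0 ≤ p) :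
    Integrable (fun ξ => ‖ξ‖ ^ p * ‖g ξ‖^2) := by
  obtain ⟨k, hk⟩ := exists_nat_ge p
  obtain ⟨M, hM⟩ : ∃ M, ∀ x, ‖g x‖ ≤ M := ⟨_, fun x => SchwartzMap.norm_le_seminorm ℝ g x⟩
  have h0 : Integrable (fun ξ => (‖g ξ‖ + ‖ξ‖^k * ‖g ξ‖) * M) :=
    ((g.integrable.norm).add (g.integrable_pow_mul volume k)).mul_const M
  have hc := g.continuous
  refine h0.mono' (by
    have : Measurable g := hc.measurable
    exact Measurable.aestronglyMeasurable (by fun_prop)) (ae_of_all _ fun ξ => ?_)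
  rw [Real.norm_of_nonneg (by positivity)]
  have h1 : ‖ξ‖ ^ p ≤ 1 + ‖ξ‖^k := by
    rcases le_total ‖ξ‖ 1 with h | h
    · have := Real.rpow_le_one (norm_nonneg ξ) h hp
      have : 0 ≤ ‖ξ‖^k := by positivity
      linarith
    · have := Real.rpow_le_rpow_of_exponent_le h hk
      rw [Real.rpow_natCast] at this
      linarith
  calc ‖ξ‖ ^ p * ‖g ξ‖^2 ≤ (1 + ‖ξ‖^k) * (‖g ξ‖ * M) := by
        rw [pow_two]
        gcongr
        exact hM ξ
    _ = _ := by ring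

lemma ofReal_int_le {X : Type*} [MeasurableSpace X] (μ : Measure X) (f : X → ℝ) (hf : ∀ x, 0 ≤ f x) :
    ENNReal.ofReal (∫ x, f x ∂μ) ≤ ∫⁻ x, ENNReal.ofReal (f x) ∂μ := by
  have h := enorm_integral_le_lintegral_enorm (μ := μ) f
  rw [Real.enorm_of_nonneg (integral_nonneg hf)] at h
  refine h.trans (le_of_eq (lintegral_congr fun x => ?_))
  rw [Real.enorm_of_nonneg (hf x)]

/-- (Morawetz-type weighted `L²` estimate) For `n ≥ 2` and `1/2 < s < n/2` there is
`C` so that for all Schwartz `φ`,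
`‖ |x|^{-s} e^{it|D|} φ ‖_{L²(ℝ₊×ℝⁿ)} ≤ C ‖ |D|^{s-1/2} φ ‖_{L²}`. -/
theorem stmt6 (n : ℕ) (hn : 2 ≤ n) (s : ℝ) (hs1 : 1/2 < s) (hs2 : s < (n : ℝ) / 2) :
    ∃ C > 0, ∀ φ : SchwartzMap (Euc n) ℂ,
      (∫ t in Ioi (0 : ℝ), ∫ x : Euc n,
          ‖x‖ ^ (-(2 * s)) * ‖halfWave t (fun y => φ y) x‖ ^ 2) ^ (1/2 : ℝ)
        ≤ C * (∫ ξ : Euc n, ‖ξ‖ ^ (2 * (s - 1/2)) * ‖𝓕 (fun y => φ y) ξ‖ ^ 2) ^ (1/2 : ℝ) := by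
  obtain ⟨C, hC, hmain⟩ := main_lint n hn s hs1 hs2
  have hp : 0 < 2 * s - 1 := by linarith
  refine ⟨C ^ (1/2 : ℝ), by positivity, fun φ => ?_⟩
  set g : SchwartzMap (Euc n) ℂ := 𝓕 φ with hg
  have hgφ : ∀ ξ, 𝓕 (fun y => φ y) ξ = g ξ := fun ξ => rfl
  have hgm : Measurable g := g.continuous.measurable
  have hB : ∫⁻ a, ENNReal.ofReal (‖g a‖^2) ≠ ⊤ := by
    have h := sch_int g (le_refl (0:ℝ))
    simp only [Real.rpow_zero, one_mul] at h
    rw [← ofReal_integral_eq_lintegral_ofReal h (ae_of_all _ fun _ => by positivity)]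
    exact ENNReal.ofReal_ne_top
  have hm := hmain g hgm g.integrable hB
  have hI := sch_int g hp.le
  have hexp : 2 * (s - 1/2) = 2 * s - 1 := by ring
  have hhw : ∀ t x, halfWave t (fun y => φ y) x = ∫ y, phs ((t, x), y) * g y := fun t x => rfl
  simp only [hgφ, hexp, hhw]
  have hU := U_meas g hgm
  have hR : ∫⁻ a, ENNReal.ofReal (‖g a‖^2) * ENNReal.ofReal (‖a‖ ^ (2*s-1)) =
      ENNReal.ofReal (∫ ξ : Euc n, ‖ξ‖ ^ (2*s-1) * ‖g ξ‖^2) := by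
    rw [ofReal_integral_eq_lintegral_ofReal hI (ae_of_all _ fun _ => by positivity)]
    refine lintegral_congr fun a => ?_
    rw [mul_comm, ENNReal.ofReal_mul (by positivity)]
  rw [hR, ← ENNReal.ofReal_mul hC.le] at hm
  have hRnn : 0 ≤ ∫ ξ : Euc n, ‖ξ‖ ^ (2*s-1) * ‖g ξ‖^2 := integral_nonneg fun _ => by positivity
  have hL : ENNReal.ofReal (∫ t in Ioi (0 : ℝ), ∫ x : Euc n,
          ‖x‖ ^ (-(2 * s)) * ‖∫ y, phs ((t, x), y) * g y‖ ^ 2) ≤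
      ENNReal.ofReal (C * ∫ ξ : Euc n, ‖ξ‖ ^ (2*s-1) * ‖g ξ‖^2) := by
    refine le_trans ?_ hm
    rw [Measure.volume_eq_prod, lintegral_prod _ (by fun_prop)]
    refine (ofReal_int_le _ _ fun t => integral_nonneg fun x => by positivity).trans ?_
    refine (setLIntegral_le_lintegral _ _).trans (lintegral_mono fun t => ?_)
    refine (ofReal_int_le _ _ fun x => by positivity).trans (lintegral_mono fun x => ?_)
    rw [ENNReal.ofReal_mul (by positivity)]
  have hL' := (ENNReal.ofReal_le_ofReal_iff (by positivity)).1 hL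
  rw [← Real.mul_rpow hC.le hRnn]
  refine Real.rpow_le_rpow (integral_nonneg fun t => integral_nonneg fun x => by positivity) hL' (by norm_num)

end
end

section
/- (Pointwise weighted sup bound for half-wave) For $n \ge 2$ and $-(n-1)/2 < \alpha < 0$, there is a constant $C$ so that for all Schwartz $\varphi$, $\sup_{t \in \mathbb{R}} \sup_{r > 0} r^{-\alpha} \left( \int_{S^{n-1}} |(e^{it|D|}\varphi)(r\omega)|^2 d\sigma(\omega) \right)^{1/2} \le C \|\varphi\|_{\dot H^{n/2+\alpha}(\mathbb{R}^n)}$. -/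
open MeasureTheory Real Set FourierTransform
open scoped RealInnerProductSpace

noncomputable section

lemma lint_gauss {n : ℕ} {b : ℝ} (hb : 0 < b) (y : Euc n) :
    ∫⁻ x : Euc n, ENNReal.ofReal (rexp (-b * ‖x - y‖ ^ 2)) =
      ENNReal.ofReal ((π / b) ^ ((n : ℝ) / 2)) := by
  rw [lintegral_sub_right_eq_self (fun x : Euc n => ENNReal.ofReal (rexp (-b * ‖x‖ ^ 2))) y]
  have h := GaussianFourier.integral_rexp_neg_mul_sq_norm (V := Euc n) hb
  rw [finrank_euclideanSpace_fin] at h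
  rw [← h, ofReal_integral_eq_lintegral_ofReal]
  · apply Integrable.of_integral_ne_zero
    rw [h]
    positivity
  · exact Filter.Eventually.of_forall fun x => (exp_pos _).le

lemma tube_pt {n : ℕ} (ω : Euc n) (hω : ‖ω‖ = 1) {l : ℝ} (hl : 0 < l) (hl1 : l ≤ 1)
    (x : Euc n) (hx : ‖x‖ < 1) :
    ENNReal.ofReal (rexp (-(π / l) * ‖x - ‖x‖ • ω‖ ^ 2)) ≤
      ENNReal.ofReal (rexp π * (√l)⁻¹) *
        ∫⁻ a in Ioc (0 : ℝ) 2, ENNReal.ofReal (rexp (-(π / (2 * l)) * ‖x - a • ω‖ ^ 2)) := by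
  have hs : 0 < √l := sqrt_pos.2 hl
  have hs1 : √l ≤ 1 := Real.sqrt_le_one.2 hl1
  have hss : √l ^ 2 = l := sq_sqrt hl.le
  have hsub : Ioc ‖x‖ (‖x‖ + √l) ⊆ Ioc (0 : ℝ) 2 := by
    intro a ha
    exact ⟨(norm_nonneg x).trans_lt ha.1, by linarith [ha.2]⟩
  have key : ENNReal.ofReal (√l) * ENNReal.ofReal (rexp (-π) *
      rexp (-(π / l) * ‖x - ‖x‖ • ω‖ ^ 2)) ≤
      ∫⁻ a in Ioc (0 : ℝ) 2, ENNReal.ofReal (rexp (-(π / (2 * l)) * ‖x - a • ω‖ ^ 2)) := by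
    calc _ = ∫⁻ a in Ioc ‖x‖ (‖x‖ + √l), ENNReal.ofReal (rexp (-π) *
              rexp (-(π / l) * ‖x - ‖x‖ • ω‖ ^ 2)) := by
            rw [setLIntegral_const, Real.volume_Ioc, mul_comm]; simp
      _ ≤ ∫⁻ a in Ioc ‖x‖ (‖x‖ + √l),
            ENNReal.ofReal (rexp (-(π / (2 * l)) * ‖x - a • ω‖ ^ 2)) := by
            apply setLIntegral_mono' measurableSet_Ioc
            intro a ha
            apply ENNReal.ofReal_le_ofReal
            rw [← Real.exp_add]
            apply Real.exp_le_exp.2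
            have h1 : ‖x - a • ω‖ ≤ ‖x - ‖x‖ • ω‖ + √l := by
              have : x - a • ω = (x - ‖x‖ • ω) + (‖x‖ - a) • ω := by
                rw [sub_smul]; abel
              rw [this]
              refine (norm_add_le _ _).trans ?_
              gcongr
              rw [norm_smul, hω, mul_one, Real.norm_eq_abs, abs_le]
              constructor <;> linarith [ha.1, ha.2]
            have h2 : ‖x - a • ω‖ ^ 2 ≤ 2 * ‖x - ‖x‖ • ω‖ ^ 2 + 2 * l := by
              have := pow_le_pow_left₀ (norm_nonneg _) h1 2
              nlinarith [sq_nonneg (‖x - ‖x‖ • ω‖ - √l)]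
            have h3 : π / (2 * l) * ‖x - a • ω‖ ^ 2 ≤
                π / (2 * l) * (2 * ‖x - ‖x‖ • ω‖ ^ 2 + 2 * l) := by gcongr
            have h4 : π / (2 * l) * (2 * ‖x - ‖x‖ • ω‖ ^ 2 + 2 * l) =
                π / l * ‖x - ‖x‖ • ω‖ ^ 2 + π := by field_simp
            linarith
      _ ≤ _ := lintegral_mono_set hsub
  calc _ = ENNReal.ofReal (rexp π * (√l)⁻¹) * (ENNReal.ofReal (√l) * ENNReal.ofReal (rexp (-π) *
      rexp (-(π / l) * ‖x - ‖x‖ • ω‖ ^ 2))) := by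
        rw [← ENNReal.ofReal_mul (by positivity), ← ENNReal.ofReal_mul (by positivity)]
        congr 1
        rw [Real.exp_neg π]
        field_simp
    _ ≤ _ := by gcongr

lemma tube_int {n : ℕ} (ω : Euc n) (hω : ‖ω‖ = 1) {l : ℝ} (hl : 0 < l) (hl1 : l ≤ 1) :
    ∫⁻ x in Metric.ball (0 : Euc n) 1, ENNReal.ofReal (rexp (-(π / l) * ‖x - ‖x‖ • ω‖ ^ 2)) ≤
      ENNReal.ofReal (rexp π * 2 * 2 ^ ((n : ℝ) / 2) * l ^ (((n : ℝ) - 1) / 2)) := by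
  calc _ ≤ ∫⁻ x in Metric.ball (0 : Euc n) 1, ENNReal.ofReal (rexp π * (√l)⁻¹) *
        ∫⁻ a in Ioc (0 : ℝ) 2, ENNReal.ofReal (rexp (-(π / (2 * l)) * ‖x - a • ω‖ ^ 2)) := by
        apply setLIntegral_mono' measurableSet_ball
        intro x hx
        exact tube_pt ω hω hl hl1 x (by simpa using hx)
    _ ≤ ∫⁻ x, ENNReal.ofReal (rexp π * (√l)⁻¹) *
        ∫⁻ a in Ioc (0 : ℝ) 2, ENNReal.ofReal (rexp (-(π / (2 * l)) * ‖x - a • ω‖ ^ 2)) :=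
        setLIntegral_le_lintegral _ _
    _ = ENNReal.ofReal (rexp π * (√l)⁻¹) * ∫⁻ a in Ioc (0 : ℝ) 2, ∫⁻ x : Euc n,
          ENNReal.ofReal (rexp (-(π / (2 * l)) * ‖x - a • ω‖ ^ 2)) := by
        rw [lintegral_const_mul' _ _ ENNReal.ofReal_ne_top]
        rw [lintegral_lintegral_swap]
        apply Measurable.aemeasurable
        apply ENNReal.measurable_ofReal.comp
        apply Continuous.measurable
        fun_prop
    _ = _ := by
        simp_rw [lint_gauss (n := n) (show 0 < π / (2 * l) by positivity)]
        rw [setLIntegral_const, Real.volume_Ioc, ← ENNReal.ofReal_mul (by positivity),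
          ← ENNReal.ofReal_mul (by positivity)]
        congr 1
        have : π / (π / (2 * l)) = 2 * l := by field_simp
        rw [this, mul_rpow (by norm_num) hl.le, sqrt_eq_rpow, sub_div, rpow_sub hl]
        field_simp
        ring

abbrev sgm (n : ℕ) : Measure (Sph n) := (volume : Measure (Euc n)).toSphere

lemma sph_gauss {n : ℕ} (hn : 2 ≤ n) (ω : Sph n) {l : ℝ} (hl : 0 < l) (hl1 : l ≤ 1) :
    ∫⁻ η : Sph n, ENNReal.ofReal (rexp (-(π / l) * ‖(ω : Euc n) - η‖ ^ 2)) ∂(sgm n) ≤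
      ENNReal.ofReal (n * (rexp π * 2 * 2 ^ ((n : ℝ) / 2)) * l ^ (((n : ℝ) - 1) / 2)) := by
  have hω : ‖(ω : Euc n)‖ = 1 := by simp
  let V := Measure.volumeIoiPow (Module.finrank ℝ (Euc n) - 1)
  let U : Set (Ioi (0 : ℝ)) := Iio ⟨1, mem_Ioi.2 one_pos⟩
  have hn0 : (0 : ℝ) < n := by positivity
  have hVU : V U = ENNReal.ofReal (1 / n) := by
    show Measure.volumeIoiPow _ _ = _
    rw [Measure.volumeIoiPow_apply_Iio, finrank_euclideanSpace_fin]
    congr 1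
    have : ((n - 1 : ℕ) : ℝ) = n - 1 := by rw [Nat.cast_sub (by omega)]; simp
    rw [this]; simp
  let G : Euc n → ENNReal := fun x => (Metric.ball (0 : Euc n) 1).indicator
    (fun x => ENNReal.ofReal (rexp (-(π / l) * ‖x - ‖x‖ • (ω : Euc n)‖ ^ 2))) x
  have hGm : Measurable G := by
    apply Measurable.indicator _ measurableSet_ball
    fun_prop
  have h1 : (∫⁻ η : Sph n, ENNReal.ofReal (rexp (-(π / l) * ‖(ω : Euc n) - η‖ ^ 2)) ∂(sgm n))
      * ENNReal.ofReal (1 / n) ≤ ∫⁻ x, G x := by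
    have hmp := (volume : Measure (Euc n)).measurePreserving_homeomorphUnitSphereProd
    calc _ = ∫⁻ η : Sph n, ∫⁻ t in U,
            ENNReal.ofReal (rexp (-(π / l) * ‖(ω : Euc n) - η‖ ^ 2)) ∂V ∂(sgm n) := by
          simp_rw [setLIntegral_const, hVU]
          rw [lintegral_mul_const' _ _ ENNReal.ofReal_ne_top]
      _ ≤ ∫⁻ η : Sph n, ∫⁻ t, G ((t : ℝ) • (η : Euc n)) ∂V ∂(sgm n) := by
          apply lintegral_mono
          intro η
          have hη : ‖(η : Euc n)‖ = 1 := by simp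
          show ∫⁻ t in U, _ ∂V ≤ ∫⁻ t, G ((t : ℝ) • (η : Euc n)) ∂V
          rw [← lintegral_indicator (measurableSet_Iio)]
          apply lintegral_mono
          intro t
          show U.indicator _ t ≤ _
          by_cases ht : t ∈ U
          · have ht0 : (0 : ℝ) < t := t.2
            have ht1 : (t : ℝ) < 1 := ht
            have hnt : ‖(t : ℝ) • (η : Euc n)‖ = t := by
              rw [norm_smul, hη, mul_one, Real.norm_of_nonneg ht0.le]
            rw [indicator_of_mem ht]
            show _ ≤ (Metric.ball (0 : Euc n) 1).indicator _ _
            rw [indicator_of_mem (by rw [mem_ball_zero_iff, hnt]; exact ht1)]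
            apply ENNReal.ofReal_le_ofReal
            apply Real.exp_le_exp.2
            rw [hnt, ← smul_sub, norm_smul, Real.norm_of_nonneg ht0.le, norm_sub_rev]
            have : ((t : ℝ) * ‖(ω : Euc n) - η‖) ^ 2 ≤ ‖(ω : Euc n) - η‖ ^ 2 := by
              apply pow_le_pow_left₀ (by positivity)
              exact mul_le_of_le_one_left (norm_nonneg _) ht1.le
            have h3 := mul_le_mul_of_nonneg_left this (show 0 ≤ π / l by positivity)
            rw [norm_sub_rev (η : Euc n)]
            linarith
          · rw [indicator_of_notMem ht]; exact zero_le
      _ = ∫⁻ p : Sph n × Ioi (0 : ℝ), G ((p.2 : ℝ) • (p.1 : Euc n)) ∂((sgm n).prod V) := by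
          rw [lintegral_prod]
          apply Measurable.aemeasurable
          apply hGm.comp
          apply Continuous.measurable
          fun_prop
      _ = ∫⁻ x : ({0}ᶜ : Set (Euc n)), G x.1 ∂(Measure.comap Subtype.val volume) := by
          rw [← hmp.lintegral_comp_emb (Homeomorph.measurableEmbedding _)]
          apply lintegral_congr
          intro x
          congr 1
          have := congrArg Subtype.val ((homeomorphUnitSphereProd (Euc n)).symm_apply_apply x)
          rw [homeomorphUnitSphereProd_symm_apply_coe] at this
          exact this
      _ = ∫⁻ x in {0}ᶜ, G x := by
          rw [lintegral_subtype_comap (measurableSet_singleton _).compl]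
      _ ≤ _ := setLIntegral_le_lintegral _ _
  have h2 : ∫⁻ x, G x ≤ ENNReal.ofReal (rexp π * 2 * 2 ^ ((n : ℝ) / 2) * l ^ (((n : ℝ) - 1) / 2)) := by
    show ∫⁻ x, (Metric.ball (0 : Euc n) 1).indicator _ x ≤ _
    rw [lintegral_indicator measurableSet_ball]
    exact tube_int (ω : Euc n) hω hl hl1
  have h3 := mul_le_mul_left (h1.trans h2) (ENNReal.ofReal n)
  rw [mul_assoc, ← ENNReal.ofReal_mul (by positivity), one_div_mul_cancel hn0.ne',
    ENNReal.ofReal_one, mul_one, ← ENNReal.ofReal_mul (by positivity)] at h3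
  refine h3.trans (le_of_eq ?_)
  congr 1
  ring

/-- Fourier extension of `h` from the sphere of radius `r`. -/
def extH {n : ℕ} (r : ℝ) (h : Sph n → ℂ) (ξ : Euc n) : ℂ :=
  ∫ ω : Sph n, Complex.exp (2 * π * Complex.I * (⟪r • (ω : Euc n), ξ⟫ : ℝ)) * h ω ∂(sgm n)

lemma norm_char (x : ℝ) : ‖Complex.exp (2 * π * Complex.I * (x : ℝ))‖ = 1 := by
  have : (2 * π * Complex.I * (x : ℝ) : ℂ) = ((2 * π * x : ℝ) : ℂ) * Complex.I := by
    push_cast; ring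
  rw [this, Complex.norm_exp_ofReal_mul_I]

lemma conj_char (x : ℝ) : (starRingEnd ℂ) (Complex.exp (2 * π * Complex.I * (x : ℝ))) =
    Complex.exp (2 * π * Complex.I * ((-x : ℝ) : ℂ)) := by
  rw [← Complex.exp_conj]
  have : (starRingEnd ℂ) 2 = 2 := Complex.conj_ofNat 2
  simp [this]

lemma extH_sm {n : ℕ} (r : ℝ) {h : Sph n → ℂ} (hh : Continuous h) :
    StronglyMeasurable (extH r h) := by
  unfold extH
  apply StronglyMeasurable.integral_prod_right' (f := fun p : Euc n × Sph n =>
    Complex.exp (2 * π * Complex.I * (⟪r • (p.2 : Euc n), p.1⟫ : ℝ)) * h p.2)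
  apply Continuous.stronglyMeasurable
  fun_prop

lemma extH_sq {n : ℕ} (r : ℝ) (h : Sph n → ℂ) (ξ : Euc n) :
    ((‖extH r h ξ‖ ^ 2 : ℝ) : ℂ) = ∫ p : Sph n × Sph n,
      Complex.exp (2 * π * Complex.I * (⟪r • ((p.1 : Euc n) - p.2), ξ⟫ : ℝ)) *
        (h p.1 * (starRingEnd ℂ) (h p.2)) ∂((sgm n).prod (sgm n)) := by
  have h1 : ((‖extH r h ξ‖ ^ 2 : ℝ) : ℂ) = extH r h ξ * (starRingEnd ℂ) (extH r h ξ) := by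
    rw [Complex.mul_conj']; push_cast; rfl
  rw [h1]
  unfold extH
  rw [← integral_conj, ← integral_prod_mul]
  congr 1
  ext p
  rw [map_mul, conj_char, mul_mul_mul_comm, ← Complex.exp_add]
  congr 2
  rw [smul_sub, inner_sub_left]
  push_cast
  ring

lemma gauss_char {n : ℕ} {l r : ℝ} (hl : 0 < l) (hr : 0 < r) (w : Euc n) :
    ∫ ξ : Euc n, (rexp (-(π * l * r ^ 2) * ‖ξ‖ ^ 2) : ℂ) *
      Complex.exp (2 * π * Complex.I * (⟪r • w, ξ⟫ : ℝ)) =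
    (((l * r ^ 2) ^ (-((n : ℝ) / 2)) * rexp (-(π / l) * ‖w‖ ^ 2) : ℝ) : ℂ) := by
  have hb : 0 < ((π * l * r ^ 2 : ℝ) : ℂ).re := by
    rw [Complex.ofReal_re]; positivity
  have := GaussianFourier.integral_cexp_neg_mul_sq_norm_add hb (2 * π * Complex.I) (r • w)
  convert this using 1
  · congr 1
    ext ξ
    rw [Complex.ofReal_exp, ← Complex.exp_add]
    push_cast
    rfl
  · rw [finrank_euclideanSpace_fin]
    rw [Complex.ofReal_mul]
    congr 1
    · have h1 : (π / ((π * l * r ^ 2 : ℝ) : ℂ)) = ((1 / (l * r ^ 2) : ℝ) : ℂ) := by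
        have : (π : ℂ) ≠ 0 := by exact_mod_cast pi_ne_zero
        push_cast
        field_simp
      have h2 : ((n : ℂ) / 2) = (((n : ℝ) / 2 : ℝ) : ℂ) := by push_cast; rfl
      rw [h1, h2, ← Complex.ofReal_cpow (by positivity), rpow_neg (by positivity), one_div,
        inv_rpow (by positivity)]
    · rw [Complex.ofReal_exp]
      congr 1
      rw [norm_smul, Real.norm_of_nonneg hr.le]
      have : (π : ℂ) ≠ 0 := by exact_mod_cast pi_ne_zero
      have : (l : ℂ) ≠ 0 := by exact_mod_cast hl.ne'
      have : (r : ℂ) ≠ 0 := by exact_mod_cast hr.ne'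
      push_cast
      rw [mul_pow, Complex.I_sq]
      field_simp
      ring

lemma gauss_integrable {n : ℕ} {b : ℝ} (hb : 0 < b) :
    Integrable (fun ξ : Euc n => rexp (-b * ‖ξ‖ ^ 2)) := by
  apply Integrable.of_integral_ne_zero
  rw [GaussianFourier.integral_rexp_neg_mul_sq_norm hb]
  positivity

lemma two_mul_enorm (a b : ℂ) : 2 * (‖a‖ₑ * ‖b‖ₑ) ≤ ‖a‖ₑ ^ 2 + ‖b‖ₑ ^ 2 := by
  simp only [enorm_eq_nnnorm]
  norm_cast
  rw [← NNReal.coe_le_coe]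
  push_cast
  nlinarith [sq_nonneg (‖a‖ - ‖b‖)]

lemma ext_gauss {n : ℕ} {l r : ℝ} (hl : 0 < l) (hr : 0 < r) {h : Sph n → ℂ} (hh : Continuous h)
    (B : ENNReal) (hB : ∀ ω : Sph n,
      ∫⁻ η : Sph n, ENNReal.ofReal (rexp (-(π / l) * ‖(ω : Euc n) - η‖ ^ 2)) ∂(sgm n) ≤ B) :
    ∫⁻ ξ : Euc n, ENNReal.ofReal (rexp (-(π * l * r ^ 2) * ‖ξ‖ ^ 2)) * ‖extH r h ξ‖ₑ ^ 2 ≤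
      ENNReal.ofReal ((l * r ^ 2) ^ (-((n : ℝ) / 2))) * (B * ∫⁻ ω, ‖h ω‖ₑ ^ 2 ∂(sgm n)) := by
  obtain ⟨M, hM⟩ : ∃ M, ∀ ω, ‖h ω‖ ≤ M := by
    obtain ⟨M, hM⟩ := (isCompact_range hh).isBounded.exists_norm_le
    exact ⟨M, fun ω => hM _ ⟨ω, rfl⟩⟩
  have hbb : 0 < π * l * r ^ 2 := by positivity
  have hHb : ∀ ξ, ‖extH r h ξ‖ ≤ M * (sgm n).real univ := by
    intro ξ
    apply norm_integral_le_of_norm_le_const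
    refine Filter.Eventually.of_forall fun ω => ?_
    rw [norm_mul, norm_char, one_mul]; exact hM ω
  have hint : Integrable (fun ξ : Euc n =>
      rexp (-(π * l * r ^ 2) * ‖ξ‖ ^ 2) * ‖extH r h ξ‖ ^ 2) := by
    apply (gauss_integrable hbb).mul_bdd (c := (M * (sgm n).real univ) ^ 2)
    · exact ((extH_sm r hh).norm.pow 2).aestronglyMeasurable
    · refine Filter.Eventually.of_forall fun ξ => ?_
      rw [norm_pow, norm_norm]
      exact pow_le_pow_left₀ (norm_nonneg _) (hHb ξ) 2
  -- the double integral
  have hcx : ((∫ ξ : Euc n, rexp (-(π * l * r ^ 2) * ‖ξ‖ ^ 2) * ‖extH r h ξ‖ ^ 2 : ℝ) : ℂ) =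
      ∫ p : Sph n × Sph n, (h p.1 * (starRingEnd ℂ) (h p.2)) *
        (((l * r ^ 2) ^ (-((n : ℝ) / 2)) * rexp (-(π / l) * ‖(p.1 : Euc n) - p.2‖ ^ 2) : ℝ) : ℂ)
          ∂((sgm n).prod (sgm n)) := by
    rw [← integral_complex_ofReal]
    simp_rw [Complex.ofReal_mul _ (‖extH r h _‖ ^ 2), extH_sq, ← integral_const_mul]
    rw [integral_integral_swap]
    · congr 1
      ext p
      rw [← gauss_char hl hr, ← integral_const_mul]
      congr 1
      ext ξ
      ring
    · have hg : Integrable (fun q : Euc n × (Sph n × Sph n) =>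
          rexp (-(π * l * r ^ 2) * ‖q.1‖ ^ 2) * (M * M))
          (volume.prod ((sgm n).prod (sgm n))) :=
        (gauss_integrable hbb).mul_prod (integrable_const (M * M))
      refine hg.mono' ?_ ?_
      · apply Continuous.aestronglyMeasurable
        simp only [Function.uncurry_def]
        fun_prop
      · refine Filter.Eventually.of_forall fun q => ?_
        simp only [Function.uncurry_def]
        rw [norm_mul, norm_mul, norm_mul, norm_char, one_mul, RCLike.norm_conj,
          Complex.norm_real, Real.norm_of_nonneg (exp_pos _).le]
        have := hM q.2.1
        have := hM q.2.2
        have : 0 ≤ M := (norm_nonneg _).trans this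
        gcongr
  have hL : ∫⁻ ξ : Euc n, ENNReal.ofReal (rexp (-(π * l * r ^ 2) * ‖ξ‖ ^ 2)) *
      ‖extH r h ξ‖ₑ ^ 2 =
      ‖((∫ ξ : Euc n, rexp (-(π * l * r ^ 2) * ‖ξ‖ ^ 2) * ‖extH r h ξ‖ ^ 2 : ℝ) : ℂ)‖ₑ := by
    have h0 : 0 ≤ ∫ ξ : Euc n, rexp (-(π * l * r ^ 2) * ‖ξ‖ ^ 2) * ‖extH r h ξ‖ ^ 2 :=
      integral_nonneg fun ξ => by positivity
    rw [← ofReal_norm, Complex.norm_real, Real.norm_of_nonneg h0,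
      ofReal_integral_eq_lintegral_ofReal hint
        (Filter.Eventually.of_forall fun ξ => by positivity)]
    congr 1
    ext ξ
    rw [ENNReal.ofReal_mul (exp_pos _).le, ENNReal.ofReal_pow (norm_nonneg _),
      ofReal_norm]
  rw [hL, hcx]
  set c := ENNReal.ofReal ((l * r ^ 2) ^ (-((n : ℝ) / 2))) with hc
  let K : Sph n → Sph n → ENNReal := fun ω η =>
    ENNReal.ofReal (rexp (-(π / l) * ‖(ω : Euc n) - η‖ ^ 2))
  have hKm : Measurable (fun p : Sph n × Sph n => K p.1 p.2) := by
    apply ENNReal.measurable_ofReal.comp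
    apply Continuous.measurable
    fun_prop
  have hhm : Measurable (fun ω => ‖h ω‖ₑ ^ 2) := by
    exact (hh.measurable.enorm).pow_const 2
  refine (enorm_integral_le_lintegral_enorm _).trans ?_
  have h2 : 2 * ∫⁻ p : Sph n × Sph n, ‖h p.1‖ₑ * ‖h p.2‖ₑ * K p.1 p.2
      ∂((sgm n).prod (sgm n)) ≤ 2 * (B * ∫⁻ ω, ‖h ω‖ₑ ^ 2 ∂(sgm n)) := by
    calc _ = ∫⁻ p : Sph n × Sph n, 2 * (‖h p.1‖ₑ * ‖h p.2‖ₑ * K p.1 p.2)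
            ∂((sgm n).prod (sgm n)) := by
          rw [lintegral_const_mul' _ _ (by simp)]
      _ ≤ ∫⁻ p : Sph n × Sph n, (‖h p.1‖ₑ ^ 2 * K p.1 p.2 + ‖h p.2‖ₑ ^ 2 * K p.1 p.2)
            ∂((sgm n).prod (sgm n)) := by
          apply lintegral_mono
          intro p
          show 2 * (‖h p.1‖ₑ * ‖h p.2‖ₑ * K p.1 p.2) ≤ ‖h p.1‖ₑ ^ 2 * K p.1 p.2 + ‖h p.2‖ₑ ^ 2 * K p.1 p.2
          rw [← mul_assoc, ← add_mul]
          gcongr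
          exact two_mul_enorm _ _
      _ = (∫⁻ ω, ∫⁻ η, ‖h ω‖ₑ ^ 2 * K ω η ∂(sgm n) ∂(sgm n)) +
          ∫⁻ η, ∫⁻ ω, ‖h η‖ₑ ^ 2 * K ω η ∂(sgm n) ∂(sgm n) := by
          have m1 : Measurable fun p : Sph n × Sph n => ‖h p.1‖ₑ ^ 2 * K p.1 p.2 :=
            (hhm.comp measurable_fst).mul hKm
          have m2 : Measurable fun p : Sph n × Sph n => ‖h p.2‖ₑ ^ 2 * K p.1 p.2 :=
            (hhm.comp measurable_snd).mul hKm
          rw [lintegral_add_left m1, lintegral_prod _ m1.aemeasurable,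
            lintegral_prod_symm _ m2.aemeasurable]
      _ ≤ (∫⁻ ω, ‖h ω‖ₑ ^ 2 * B ∂(sgm n)) + ∫⁻ η, ‖h η‖ₑ ^ 2 * B ∂(sgm n) := by
          gcongr with ω η
          · rw [lintegral_const_mul' _ _ (by simp)]
            gcongr
            exact hB ω
          · rw [lintegral_const_mul' _ _ (by simp)]
            gcongr
            refine le_trans (le_of_eq ?_) (hB η)
            congr 1
            ext ω
            simp only [K]
            rw [norm_sub_rev]
      _ = _ := by
          rw [lintegral_mul_const _ hhm, two_mul, mul_comm B]
  have h3 := (ENNReal.mul_le_mul_iff_right (by simp) (by simp)).1 h2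
  calc _ = ∫⁻ p : Sph n × Sph n, c * (‖h p.1‖ₑ * ‖h p.2‖ₑ * K p.1 p.2)
            ∂((sgm n).prod (sgm n)) := by
          apply lintegral_congr
          intro p
          rw [enorm_mul, enorm_mul, ← ofReal_norm (Complex.ofReal _), Complex.norm_real,
            Real.norm_of_nonneg (by positivity), ENNReal.ofReal_mul (by positivity),
            RCLike.enorm_conj]
          ring
    _ = c * _ := lintegral_const_mul' _ _ ENNReal.ofReal_ne_top
    _ ≤ _ := by gcongr

/-- Uniform bound for the Gaussian mean over the sphere. -/
def aBd (n : ℕ) (l : ℝ) : ENNReal :=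
  if l ≤ 1 then ENNReal.ofReal (n * (rexp π * 2 * 2 ^ ((n : ℝ) / 2)) * l ^ (((n : ℝ) - 1) / 2))
  else sgm n univ

lemma aBd_spec {n : ℕ} (hn : 2 ≤ n) (ω : Sph n) {l : ℝ} (hl : 0 < l) :
    ∫⁻ η : Sph n, ENNReal.ofReal (rexp (-(π / l) * ‖(ω : Euc n) - η‖ ^ 2)) ∂(sgm n) ≤
      aBd n l := by
  unfold aBd
  split_ifs with h
  · exact sph_gauss hn ω hl h
  · calc _ ≤ ∫⁻ η : Sph n, 1 ∂(sgm n) := by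
          apply lintegral_mono
          intro η
          show ENNReal.ofReal _ ≤ 1
          rw [ENNReal.ofReal_le_one, Real.exp_le_one_iff]
          have : 0 ≤ π / l * ‖(ω : Euc n) - η‖ ^ 2 := by positivity
          linarith
      _ = _ := by simp

lemma aBd_int (n : ℕ) (α : ℝ) (hα1 : -(((n : ℝ) - 1) / 2) < α) (hα2 : α < 0) :
    ∫⁻ l in Ioi (0 : ℝ), ENNReal.ofReal (l ^ (α - 1)) * aBd n l < ⊤ := by
  rw [← Ioc_union_Ioi_eq_Ioi (zero_le_one' ℝ)]
  refine (lintegral_union_le _ _ _).trans_lt (ENNReal.add_lt_top.2 ⟨?_, ?_⟩)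
  · set c : ℝ := n * (rexp π * 2 * 2 ^ ((n : ℝ) / 2)) with hc
    have hi : IntegrableOn (fun l : ℝ => c * l ^ (α - 1 + ((n : ℝ) - 1) / 2)) (Ioc 0 1) := by
      apply Integrable.const_mul
      have := intervalIntegral.intervalIntegrable_rpow' (a := 0) (b := 1)
        (r := α - 1 + ((n : ℝ) - 1) / 2) (by linarith)
      rwa [intervalIntegrable_iff_integrableOn_Ioc_of_le zero_le_one] at this
    refine lt_of_eq_of_lt ?_ hi.lintegral_lt_top
    apply setLIntegral_congr_fun measurableSet_Ioc
    intro l hl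
    show ENNReal.ofReal (l ^ (α - 1)) * aBd n l =
      ENNReal.ofReal (c * l ^ (α - 1 + ((n : ℝ) - 1) / 2))
    rw [aBd, if_pos hl.2, ← ENNReal.ofReal_mul (rpow_nonneg hl.1.le _), rpow_add hl.1]
    congr 1
    ring
  · have hi : IntegrableOn (fun l : ℝ => l ^ (α - 1)) (Ioi 1) :=
      integrableOn_Ioi_rpow_of_lt (by linarith) one_pos
    calc _ = ∫⁻ l in Ioi (1 : ℝ), ENNReal.ofReal (l ^ (α - 1)) * sgm n univ := by
          apply setLIntegral_congr_fun measurableSet_Ioi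
          intro l hl
          show ENNReal.ofReal (l ^ (α - 1)) * aBd n l = _
          rw [aBd, if_neg (not_le.2 hl)]
      _ = (∫⁻ l in Ioi (1 : ℝ), ENNReal.ofReal (l ^ (α - 1))) * sgm n univ :=
          lintegral_mul_const' _ _ (measure_ne_top _ _)
      _ < ⊤ := ENNReal.mul_lt_top hi.lintegral_lt_top (measure_lt_top _ _)

lemma weight_le {n : ℕ} {s r : ℝ} (hs : 0 < s) (hr : 0 < r) (ξ : Euc n) :
    ENNReal.ofReal (‖ξ‖ ^ (-(2 * s))) ≤ ENNReal.ofReal (π ^ s / Gamma s * r ^ (2 * s)) *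
      ∫⁻ l in Ioi (0 : ℝ), ENNReal.ofReal (l ^ (s - 1)) *
        ENNReal.ofReal (rexp (-(π * l * r ^ 2) * ‖ξ‖ ^ 2)) := by
  rcases eq_or_ne ξ 0 with rfl | hξ
  · rw [norm_zero, zero_rpow (by linarith), ENNReal.ofReal_zero]
    exact zero_le
  have hx : 0 < ‖ξ‖ := norm_pos_iff.2 hξ
  have hG := Gamma_pos_of_pos hs
  have hR : 0 < π * r ^ 2 * ‖ξ‖ ^ 2 := by positivity
  have hI := Real.integral_rpow_mul_exp_neg_mul_Ioi hs hR
  have hint : IntegrableOn (fun t => t ^ (s - 1) * rexp (-(π * r ^ 2 * ‖ξ‖ ^ 2 * t)))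
      (Ioi 0) := .of_integral_ne_zero (by rw [hI]; positivity)
  have hE : ∫⁻ l in Ioi (0 : ℝ), ENNReal.ofReal (l ^ (s - 1)) *
        ENNReal.ofReal (rexp (-(π * l * r ^ 2) * ‖ξ‖ ^ 2)) =
      ENNReal.ofReal ((1 / (π * r ^ 2 * ‖ξ‖ ^ 2)) ^ s * Gamma s) := by
    rw [← hI, ofReal_integral_eq_lintegral_ofReal hint]
    · apply setLIntegral_congr_fun measurableSet_Ioi
      intro l hl
      show ENNReal.ofReal _ * ENNReal.ofReal _ = _
      rw [← ENNReal.ofReal_mul (rpow_nonneg (le_of_lt hl) _)]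
      congr 3
      ring
    · refine (ae_restrict_iff' measurableSet_Ioi).2 (Filter.Eventually.of_forall fun l hl => ?_)
      exact mul_nonneg (rpow_nonneg (le_of_lt hl) _) (exp_pos _).le
  rw [hE, ← ENNReal.ofReal_mul (by positivity)]
  apply ENNReal.ofReal_le_ofReal
  apply le_of_eq
  rw [one_div, inv_rpow hR.le, mul_rpow (by positivity) (by positivity),
    mul_rpow (by positivity) (by positivity), rpow_neg hx.le, rpow_mul hr.le, rpow_mul hx.le,
    rpow_two, rpow_two]
  field_simp

lemma ext_weight {n : ℕ} (hn : 2 ≤ n) {α : ℝ}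
    (hα1 : -(((n : ℝ) - 1) / 2) < α) {r : ℝ} (hr : 0 < r)
    {h : Sph n → ℂ} (hh : Continuous h) :
    ∫⁻ ξ : Euc n, ENNReal.ofReal (‖ξ‖ ^ (-(2 * ((n : ℝ) / 2 + α)))) * ‖extH r h ξ‖ₑ ^ 2 ≤
      ENNReal.ofReal (π ^ ((n : ℝ) / 2 + α) / Gamma ((n : ℝ) / 2 + α)) *
        (∫⁻ l in Ioi (0 : ℝ), ENNReal.ofReal (l ^ (α - 1)) * aBd n l) *
        ENNReal.ofReal (r ^ (2 * α)) * ∫⁻ ω, ‖h ω‖ₑ ^ 2 ∂(sgm n) := by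
  set s := (n : ℝ) / 2 + α with hs_def
  set X := ∫⁻ ω, ‖h ω‖ₑ ^ 2 ∂(sgm n) with hX
  have hs : 0 < s := by
    have : (2 : ℝ) ≤ n := by exact_mod_cast hn
    linarith
  have hG := Gamma_pos_of_pos hs
  have hHm : Measurable (fun ξ => ‖extH r h ξ‖ₑ ^ 2) :=
    ((extH_sm r hh).measurable.enorm).pow_const 2
  set c := ENNReal.ofReal (π ^ s / Gamma s * r ^ (2 * s)) with hc
  have hXfin : X ≠ ⊤ := by
    have : Integrable (fun ω => ‖h ω‖ ^ 2) (sgm n) :=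
      (by fun_prop : Continuous fun ω => ‖h ω‖ ^ 2).integrable_of_hasCompactSupport
        (HasCompactSupport.of_compactSpace _)
    have := this.lintegral_lt_top
    refine ne_of_lt (lt_of_eq_of_lt ?_ this)
    apply lintegral_congr
    intro ω
    rw [ENNReal.ofReal_pow (norm_nonneg _), ofReal_norm]
  calc _ ≤ ∫⁻ ξ : Euc n, c * ∫⁻ l in Ioi (0 : ℝ), ENNReal.ofReal (l ^ (s - 1)) *
        ENNReal.ofReal (rexp (-(π * l * r ^ 2) * ‖ξ‖ ^ 2)) * ‖extH r h ξ‖ₑ ^ 2 := by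
        apply lintegral_mono
        intro ξ
        show ENNReal.ofReal (‖ξ‖ ^ (-(2 * s))) * ‖extH r h ξ‖ₑ ^ 2 ≤ c * ∫⁻ l in Ioi (0 : ℝ), ENNReal.ofReal (l ^ (s - 1)) *
          ENNReal.ofReal (rexp (-(π * l * r ^ 2) * ‖ξ‖ ^ 2)) * ‖extH r h ξ‖ₑ ^ 2
        rw [lintegral_mul_const' _ _ (by simp), ← mul_assoc]
        gcongr
        exact weight_le hs hr ξ
    _ = c * ∫⁻ l in Ioi (0 : ℝ), ENNReal.ofReal (l ^ (s - 1)) * ∫⁻ ξ : Euc n,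
        ENNReal.ofReal (rexp (-(π * l * r ^ 2) * ‖ξ‖ ^ 2)) * ‖extH r h ξ‖ₑ ^ 2 := by
        rw [lintegral_const_mul' _ _ ENNReal.ofReal_ne_top, lintegral_lintegral_swap]
        · simp_rw [mul_assoc]
          congr 1
          apply lintegral_congr
          intro l
          rw [lintegral_const_mul' _ _ ENNReal.ofReal_ne_top]
        · apply Measurable.aemeasurable
          have m1 : Measurable fun q : Euc n × ℝ => ENNReal.ofReal (q.2 ^ (s - 1)) :=
            ENNReal.measurable_ofReal.comp (measurable_snd.pow_const _)
          have m2 : Measurable fun q : Euc n × ℝ =>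
              ENNReal.ofReal (rexp (-(π * q.2 * r ^ 2) * ‖q.1‖ ^ 2)) :=
            ENNReal.measurable_ofReal.comp (Continuous.measurable (by fun_prop))
          exact (m1.mul m2).mul (hHm.comp measurable_fst)
    _ ≤ c * ∫⁻ l in Ioi (0 : ℝ), ENNReal.ofReal (l ^ (s - 1)) *
          (ENNReal.ofReal ((l * r ^ 2) ^ (-((n : ℝ) / 2))) * (aBd n l * X)) := by
        gcongr 1
        apply setLIntegral_mono' measurableSet_Ioi
        intro l hl
        gcongr 1
        exact ext_gauss hl hr hh _ (fun ω => aBd_spec hn ω hl)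
    _ = c * ∫⁻ l in Ioi (0 : ℝ), ENNReal.ofReal (r ^ (-(n : ℝ))) *
          (ENNReal.ofReal (l ^ (α - 1)) * aBd n l * X) := by
        congr 1
        apply setLIntegral_congr_fun measurableSet_Ioi
        intro l hl
        have hl0 : 0 < l := hl
        have : ENNReal.ofReal (l ^ (s - 1)) * ENNReal.ofReal ((l * r ^ 2) ^ (-((n : ℝ) / 2))) =
            ENNReal.ofReal (r ^ (-(n : ℝ))) * ENNReal.ofReal (l ^ (α - 1)) := by
          rw [← ENNReal.ofReal_mul (by positivity), ← ENNReal.ofReal_mul (by positivity)]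
          congr 1
          rw [mul_rpow hl0.le (by positivity), ← rpow_two, ← rpow_mul hr.le, ← mul_assoc,
            ← rpow_add hl0, mul_comm]
          congr 2 <;> ring
        show ENNReal.ofReal (l ^ (s - 1)) *
          (ENNReal.ofReal ((l * r ^ 2) ^ (-((n : ℝ) / 2))) * (aBd n l * X)) = _
        rw [← mul_assoc, this]
        ring
    _ = _ := by
        rw [lintegral_const_mul' _ _ ENNReal.ofReal_ne_top, lintegral_mul_const' _ _ hXfin]
        have : c * ENNReal.ofReal (r ^ (-(n : ℝ))) =
            ENNReal.ofReal (π ^ s / Gamma s) * ENNReal.ofReal (r ^ (2 * α)) := by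
          rw [hc, ← ENNReal.ofReal_mul (by positivity), ← ENNReal.ofReal_mul (by positivity),
            mul_assoc, ← rpow_add hr]
          congr 3
          rw [hs_def]; ring
        rw [← mul_assoc, this]
        ring

/-- The trace estimate for a Fourier transform of an integrable continuous function. -/
lemma trace_est {n : ℕ} (hn : 2 ≤ n) {α : ℝ}
    (hα1 : -(((n : ℝ) - 1) / 2) < α) {r : ℝ} (hr : 0 < r)
    (G : Euc n → ℂ) (hG : Integrable G) (hGc : Continuous G) :
    ∫⁻ ω : Sph n, ‖∫ ξ : Euc n, Complex.exp (2 * π * Complex.I * (⟪r • (ω : Euc n), ξ⟫ : ℝ))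
        * G ξ‖ₑ ^ 2 ∂(sgm n) ≤
      ENNReal.ofReal (π ^ ((n : ℝ) / 2 + α) / Gamma ((n : ℝ) / 2 + α)) *
        (∫⁻ l in Ioi (0 : ℝ), ENNReal.ofReal (l ^ (α - 1)) * aBd n l) *
        ENNReal.ofReal (r ^ (2 * α)) *
        ∫⁻ ξ : Euc n, ENNReal.ofReal (‖ξ‖ ^ (2 * ((n : ℝ) / 2 + α)) * ‖G ξ‖ ^ 2) := by
  set F : Sph n → ℂ := fun ω =>
    ∫ ξ : Euc n, Complex.exp (2 * π * Complex.I * (⟪r • (ω : Euc n), ξ⟫ : ℝ)) * G ξ with hF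
  have hFc : Continuous F := by
    apply continuous_of_dominated (bound := fun ξ => ‖G ξ‖)
    · intro ω
      apply Continuous.aestronglyMeasurable
      fun_prop
    · intro ω
      refine Filter.Eventually.of_forall fun ξ => ?_
      rw [norm_mul, norm_char, one_mul]
    · exact hG.norm
    · refine Filter.Eventually.of_forall fun ξ => ?_
      fun_prop
  set h : Sph n → ℂ := fun ω => (starRingEnd ℂ) (F ω) with hh_def
  have hh : Continuous h := by fun_prop
  have hW := ext_weight hn hα1 hr hh
  set D := ENNReal.ofReal (π ^ ((n : ℝ) / 2 + α) / Gamma ((n : ℝ) / 2 + α)) *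
        (∫⁻ l in Ioi (0 : ℝ), ENNReal.ofReal (l ^ (α - 1)) * aBd n l) *
        ENNReal.ofReal (r ^ (2 * α)) with hD
  set s := (n : ℝ) / 2 + α with hs_def
  set X := ∫⁻ ω : Sph n, ‖F ω‖ₑ ^ 2 ∂(sgm n) with hX
  have hXh : ∫⁻ ω, ‖h ω‖ₑ ^ 2 ∂(sgm n) = X := by
    apply lintegral_congr
    intro ω
    rw [hh_def, RCLike.enorm_conj]
  rw [hXh] at hW
  set N := ∫⁻ ξ : Euc n, ENNReal.ofReal (‖ξ‖ ^ (2 * s) * ‖G ξ‖ ^ 2) with hN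
  have hFi : Integrable (fun ω => ‖F ω‖ ^ 2) (sgm n) :=
      (by fun_prop : Continuous fun ω => ‖F ω‖ ^ 2).integrable_of_hasCompactSupport
        (HasCompactSupport.of_compactSpace _)
  have hXe : X = ENNReal.ofReal (∫ ω, ‖F ω‖ ^ 2 ∂(sgm n)) := by
    rw [ofReal_integral_eq_lintegral_ofReal hFi
      (Filter.Eventually.of_forall fun ω => by positivity)]
    apply lintegral_congr
    intro ω
    rw [ENNReal.ofReal_pow (norm_nonneg _), ofReal_norm]
  have hXfin : X ≠ ⊤ := by rw [hXe]; exact ENNReal.ofReal_ne_top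
  have hsw : ((∫ ω, ‖F ω‖ ^ 2 ∂(sgm n) : ℝ) : ℂ) = ∫ ξ, G ξ * extH r h ξ := by
    have e1 : ((∫ ω, ‖F ω‖ ^ 2 ∂(sgm n) : ℝ) : ℂ) = ∫ ω : Sph n, ∫ ξ : Euc n,
        Complex.exp (2 * π * Complex.I * (⟪r • (ω : Euc n), ξ⟫ : ℝ)) * G ξ * h ω ∂volume
          ∂(sgm n) := by
      rw [← integral_complex_ofReal]
      congr 1
      ext ω
      rw [integral_mul_const]
      show _ = F ω * (starRingEnd ℂ) (F ω)
      rw [Complex.mul_conj']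
      push_cast
      rfl
    rw [e1, integral_integral_swap]
    · congr 1
      ext ξ
      rw [extH, ← integral_const_mul]
      congr 1
      ext ω
      ring
    · have hhi : Integrable h (sgm n) := hh.integrable_of_hasCompactSupport
        (HasCompactSupport.of_compactSpace _)
      have := hhi.norm.mul_prod hG.norm
      refine this.mono' ?_ ?_
      · apply Continuous.aestronglyMeasurable
        simp only [Function.uncurry_def]
        fun_prop
      · refine Filter.Eventually.of_forall fun q => ?_
        simp only [Function.uncurry_def]
        rw [norm_mul, norm_mul, norm_char, one_mul, mul_comm]
  have hHm : Measurable (extH r h) := (extH_sm r hh).measurable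
  have hX1 : X ≤ ∫⁻ ξ, ‖G ξ‖ₑ * ‖extH r h ξ‖ₑ := by
    have : X = ‖((∫ ω, ‖F ω‖ ^ 2 ∂(sgm n) : ℝ) : ℂ)‖ₑ := by
      rw [hXe, ← ofReal_norm, Complex.norm_real, Real.norm_of_nonneg]
      exact integral_nonneg fun ω => by positivity
    rw [this, hsw]
    refine (enorm_integral_le_lintegral_enorm _).trans (le_of_eq ?_)
    simp_rw [enorm_mul]
  have hHol : X ≤ N ^ (1 / 2 : ℝ) * (D * X) ^ (1 / 2 : ℝ) := by
    have hn0 : ∀ᵐ ξ : Euc n, ξ ≠ 0 := by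
      have : Nonempty (Fin n) := ⟨⟨0, by omega⟩⟩
      have : (volume : Measure (Euc n)) {0} = 0 := by
        have : Nontrivial (Euc n) := inferInstance
        exact measure_singleton 0
      rw [ae_iff]
      simp
    have h1 : ∫⁻ ξ, ‖G ξ‖ₑ * ‖extH r h ξ‖ₑ = ∫⁻ ξ,
        ((fun ξ : Euc n => ENNReal.ofReal (‖ξ‖ ^ s) * ‖G ξ‖ₑ) *
         (fun ξ : Euc n => ENNReal.ofReal (‖ξ‖ ^ (-s)) * ‖extH r h ξ‖ₑ)) ξ := by
      apply lintegral_congr_ae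
      filter_upwards [hn0] with ξ hξ
      have hx : 0 < ‖ξ‖ := norm_pos_iff.2 hξ
      rw [Pi.mul_apply, mul_mul_mul_comm, ← ENNReal.ofReal_mul (by positivity), ← rpow_add hx]
      simp
    have h2 := ENNReal.lintegral_mul_le_Lp_mul_Lq (volume : Measure (Euc n))
      (Real.HolderConjugate.two_two)
      (f := fun ξ : Euc n => ENNReal.ofReal (‖ξ‖ ^ s) * ‖G ξ‖ₑ)
      (g := fun ξ : Euc n => ENNReal.ofReal (‖ξ‖ ^ (-s)) * ‖extH r h ξ‖ₑ)
      (by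
        apply Measurable.aemeasurable
        exact (ENNReal.measurable_ofReal.comp (measurable_norm.pow_const s)).mul
          hGc.measurable.enorm)
      (by
        apply Measurable.aemeasurable
        exact (ENNReal.measurable_ofReal.comp (measurable_norm.pow_const (-s))).mul
          hHm.enorm)
    refine hX1.trans (h1.le.trans (h2.trans ?_))
    gcongr
    · apply le_of_eq
      apply lintegral_congr
      intro ξ
      rw [ENNReal.rpow_two, mul_pow, ENNReal.ofReal_mul (by positivity),
        ← ENNReal.ofReal_pow (by positivity), ENNReal.ofReal_pow (norm_nonneg (G ξ)),
        ofReal_norm, ← rpow_two, ← rpow_mul (norm_nonneg _), mul_comm s]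
    · refine le_trans (le_of_eq ?_) hW
      apply lintegral_congr
      intro ξ
      rw [ENNReal.rpow_two, mul_pow, ← ENNReal.ofReal_pow (by positivity),
        ← rpow_two, ← rpow_mul (norm_nonneg _)]
      congr 3
      ring
  rcases eq_or_ne X 0 with h0 | h0
  · rw [h0]; exact zero_le
  have hsq : X * X ≤ D * N * X := by
    have := ENNReal.rpow_le_rpow hHol (zero_le_two (α := ℝ))
    rw [ENNReal.mul_rpow_of_nonneg _ _ zero_le_two, ← ENNReal.rpow_mul, ← ENNReal.rpow_mul] at this
    norm_num at this
    rw [← sq]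
    refine this.trans (le_of_eq ?_)
    ring
  exact (ENNReal.mul_le_mul_iff_left h0 hXfin).1 hsq

lemma schwartz_weight_integrable {n : ℕ} {q : ℝ} (hq : 0 ≤ q) (ψ : SchwartzMap (Euc n) ℂ) :
    Integrable (fun ξ : Euc n => ‖ξ‖ ^ q * ‖ψ ξ‖ ^ 2) := by
  obtain ⟨M, hM⟩ : ∃ M, ∀ ξ, ‖ψ ξ‖ ≤ M := by
    obtain ⟨M, -, hM⟩ := ψ.decay 0 0
    exact ⟨M, fun ξ => by simpa using hM ξ⟩
  obtain ⟨k, hk⟩ := exists_nat_ge q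
  have hi : Integrable (fun ξ : Euc n => M * (‖ψ ξ‖ + ‖ξ‖ ^ k * ‖ψ ξ‖)) :=
    ((ψ.integrable.norm).add (ψ.integrable_pow_mul volume k)).const_mul M
  refine hi.mono' ?_ ?_
  · apply Continuous.aestronglyMeasurable
    have := ψ.continuous
    have h2 : Continuous fun ξ : Euc n => ‖ξ‖ ^ q :=
      continuous_norm.rpow_const fun _ => Or.inr hq
    fun_prop
  · refine Filter.Eventually.of_forall fun ξ => ?_
    have h1 : ‖ξ‖ ^ q ≤ 1 + ‖ξ‖ ^ k := by
      rcases le_total ‖ξ‖ 1 with h | h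
      · have := rpow_le_one (norm_nonneg ξ) h hq
        have : 0 ≤ ‖ξ‖ ^ k := by positivity
        linarith
      · have := rpow_le_rpow_of_exponent_le h hk
        rw [rpow_natCast] at this
        linarith
    rw [Real.norm_of_nonneg (by positivity)]
    have h0 : 0 ≤ M := (norm_nonneg _).trans (hM ξ)
    calc ‖ξ‖ ^ q * ‖ψ ξ‖ ^ 2 ≤ (1 + ‖ξ‖ ^ k) * (M * ‖ψ ξ‖) := by
          rw [sq]
          gcongr
          exact hM ξ
      _ = _ := by ring

/-- (Pointwise weighted sup bound for the half-wave operator) For `n ≥ 2` and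
`-(n-1)/2 < α < 0` there is `C` so that for all Schwartz `φ`, all `t` and all `r > 0`,
`r^{-α} ‖(e^{it|D|}φ)(r·)‖_{L²(S^{n-1})} ≤ C ‖φ‖_{Ḣ^{n/2+α}}`. -/
theorem stmt7 (n : ℕ) (hn : 2 ≤ n) (α : ℝ)
    (hα1 : -(((n : ℝ) - 1) / 2) < α) (hα2 : α < 0) :
    ∃ C > 0, ∀ φ : SchwartzMap (Euc n) ℂ, ∀ t : ℝ, ∀ r : ℝ, 0 < r →
      r ^ (-α) * sphL2 (halfWave t (fun y => φ y)) r
        ≤ C * hSob n ((n : ℝ) / 2 + α) (fun y => φ y) := by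
  set s := (n : ℝ) / 2 + α with hs_def
  have hs : 0 < s := by
    have : (2 : ℝ) ≤ n := by exact_mod_cast hn
    linarith
  set E := ENNReal.ofReal (π ^ s / Gamma s) *
        (∫⁻ l in Ioi (0 : ℝ), ENNReal.ofReal (l ^ (α - 1)) * aBd n l) with hE
  have hEfin : E ≠ ⊤ :=
    ENNReal.mul_ne_top ENNReal.ofReal_ne_top (aBd_int n α hα1 hα2).ne
  refine ⟨E.toReal ^ (1 / 2 : ℝ) + 1, by positivity, ?_⟩
  intro φ t r hr
  set ψ : SchwartzMap (Euc n) ℂ := 𝓕 φ with hψ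
  have hψφ : ∀ ξ, 𝓕 (fun y => φ y) ξ = ψ ξ := fun ξ => by
    rw [hψ, SchwartzMap.fourier_coe]
  have hph : ∀ ξ : Euc n, ‖Complex.exp (Complex.I * t * ‖ξ‖)‖ = 1 := by
    intro ξ
    have : (Complex.I * t * ‖ξ‖ : ℂ) = ((t * ‖ξ‖ : ℝ) : ℂ) * Complex.I := by
      push_cast; ring
    rw [this, Complex.norm_exp_ofReal_mul_I]
  let G : Euc n → ℂ := fun ξ => Complex.exp (Complex.I * t * ‖ξ‖) * ψ ξ
  have hGn : ∀ ξ, ‖G ξ‖ = ‖ψ ξ‖ := fun ξ => by rw [norm_mul, hph, one_mul]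
  have hψc := ψ.continuous
  have hGc : Continuous G := by fun_prop
  have hGi : Integrable G :=
    ψ.integrable.norm.mono' hGc.aestronglyMeasurable
      (Filter.Eventually.of_forall fun ξ => (hGn ξ).le)
  have key := trace_est hn hα1 hr G hGi hGc
  rw [← hs_def, ← hE] at key
  have hu : ∀ x : Euc n, halfWave t (fun y => φ y) x =
      ∫ ξ : Euc n, Complex.exp (2 * π * Complex.I * (⟪x, ξ⟫ : ℝ)) * G ξ := by
    intro x
    show ∫ ξ, _ = _
    congr 1
    ext ξ
    rw [hψφ, mul_assoc]
  simp_rw [← hu, hGn] at key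
  rw [← ofReal_integral_eq_lintegral_ofReal (schwartz_weight_integrable (by positivity) ψ)
    (Filter.Eventually.of_forall fun ξ => by positivity)] at key
  set I := ∫ ξ : Euc n, ‖ξ‖ ^ (2 * s) * ‖ψ ξ‖ ^ 2 with hI
  have hI0 : 0 ≤ I := integral_nonneg fun ξ => by positivity
  have hSob_eq : hSob n s (fun y => φ y) = I ^ (1 / 2 : ℝ) := by
    unfold hSob
    simp_rw [hψφ]
    rfl
  set Y := ∫ ω : Sph n, ‖halfWave t (fun y => φ y) (r • (ω : Euc n))‖ ^ 2 ∂(sgm n) with hY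
  have hY0 : 0 ≤ Y := integral_nonneg fun ξ => by positivity
  have hYle : Y ≤ E.toReal * r ^ (2 * α) * I := by
    have h1 : ENNReal.ofReal Y ≤ ENNReal.ofReal (E.toReal * r ^ (2 * α) * I) := by
      calc ENNReal.ofReal Y ≤ ‖Y‖ₑ := by rw [← ofReal_norm, Real.norm_of_nonneg hY0]
        _ ≤ ∫⁻ ω : Sph n, ‖‖halfWave t (fun y => φ y) (r • (ω : Euc n))‖ ^ 2‖ₑ ∂(sgm n) :=
            enorm_integral_le_lintegral_enorm _
        _ = ∫⁻ ω : Sph n, ‖halfWave t (fun y => φ y) (r • (ω : Euc n))‖ₑ ^ 2 ∂(sgm n) := by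
            simp_rw [enorm_pow, enorm_norm]
        _ ≤ _ := key
        _ = _ := by
            rw [ENNReal.ofReal_mul (by positivity), ENNReal.ofReal_mul (by positivity),
              ENNReal.ofReal_toReal hEfin]
    exact (ENNReal.ofReal_le_ofReal_iff (by positivity)).1 h1
  have hsph : sphL2 (halfWave t (fun y => φ y)) r = Y ^ (1 / 2 : ℝ) := rfl
  rw [hsph, hSob_eq]
  have h2 : Y ^ (1 / 2 : ℝ) ≤ E.toReal ^ (1 / 2 : ℝ) * r ^ α * I ^ (1 / 2 : ℝ) := by
    refine (rpow_le_rpow hY0 hYle (by norm_num)).trans (le_of_eq ?_)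
    rw [mul_rpow (by positivity) hI0, mul_rpow (by positivity) (by positivity),
      ← rpow_mul hr.le]
    congr 3
    ring
  have h3 : r ^ (-α) * r ^ α = 1 := by rw [← rpow_add hr]; simp
  have hIp : 0 ≤ I ^ (1 / 2 : ℝ) := by positivity
  calc r ^ (-α) * Y ^ (1 / 2 : ℝ)
      ≤ r ^ (-α) * (E.toReal ^ (1 / 2 : ℝ) * r ^ α * I ^ (1 / 2 : ℝ)) := by gcongr
    _ = (r ^ (-α) * r ^ α) * (E.toReal ^ (1 / 2 : ℝ) * I ^ (1 / 2 : ℝ)) := by ring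
    _ = E.toReal ^ (1 / 2 : ℝ) * I ^ (1 / 2 : ℝ) := by rw [h3, one_mul]
    _ ≤ _ := by gcongr; linarith

end
end
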